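/- arXiv:1708.08846 — 2 statements merged into one kernel-verified Lean document; each statement's English description precedes it below -/
import Mathlib

section
/- Fix p > 2 and q = p/(p−1). The map η : (0,1) × (−1,1) → ℝ², defined by η(τ,R) = ( (−τ + (1−τ)ρ(R)) / (τ + (1−τ)ρ(R)^p)^{1/p}, (−τ + (1−τ)φ(R)) / (τ + (1−τ)|R|^p)^{1/q} ), is a bijection from (0,1) × (−1,1) onto the open triangle { (y₁,y₂) ∈ ℝ² : −1 < y₂ < y₁ < 1 }. -/
/-- φ(R) = R·|R|^{p-2}. -/
noncomputable def phi (p R : ℝ) : ℝ := R * |R| ^ (p - 2)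

/-- The function λ from the paper. -/
noncomputable def lam (p R : ℝ) : ℝ :=
  if R = -1 then -(p - 2) / 2 else 1 / (1 + R) - (p - 1) / (1 + phi p R)

open Set Filter Topology

/-- `E X / (E |X|^r)^e` for `X = -1` with probability `τ` and `X = s`, `|X|^r = P` otherwise. -/
noncomputable def normalizedMean (e s P τ : ℝ) : ℝ :=
  (-τ + (1 - τ) * s) / (τ + (1 - τ) * P) ^ e

theorem hasDerivAt_div_rpow {N D : ℝ → ℝ} {N' D' x e : ℝ} (hN : HasDerivAt N N' x)
    (hD : HasDerivAt D D' x) (h : 0 < D x) :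
    HasDerivAt (fun t => N t / D t ^ e) ((N' * D x - e * N x * D') / D x ^ (e + 1)) x := by
  have h1 := hN.div (hD.rpow_const (p := e) (Or.inl h.ne')) (by positivity)
  refine h1.congr_deriv ?_
  have h2 : D x ^ e = D x * D x ^ (e - 1) := by
    rw [Real.rpow_sub_one h.ne']; field_simp
  have h3 : D x ^ (e + 1) = D x * (D x * D x ^ (e - 1)) := by
    rw [Real.rpow_add_one h.ne', ← h2]; ring
  have : 0 < D x ^ (e - 1) := by positivity
  rw [h3, h2]
  field_simp

theorem hasDerivAt_normalizedMean {s P τ : ℝ → ℝ} {s' P' τ' x e : ℝ} (hs : HasDerivAt s s' x)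
    (hP : HasDerivAt P P' x) (hτ : HasDerivAt τ τ' x) (h : 0 < τ x + (1 - τ x) * P x) :
    HasDerivAt (fun t => normalizedMean e (s t) (P t) (τ t))
      (((1 - τ x) * (s' * (τ x + (1 - τ x) * P x) - e * (-τ x + (1 - τ x) * s x) * P')
        - τ' * ((1 + s x) * (τ x + (1 - τ x) * P x) + e * (-τ x + (1 - τ x) * s x) * (1 - P x)))
        / (τ x + (1 - τ x) * P x) ^ (e + 1)) x := by
  have hb : HasDerivAt (fun t => 1 - τ t) (-τ') x := by simpa using hτ.const_sub 1
  have h1 := hasDerivAt_div_rpow (e := e) (hτ.neg.add (hb.mul hs)) (hτ.add (hb.mul hP)) h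
  refine h1.congr_deriv ?_
  simp only [Pi.add_apply, Pi.mul_apply, Pi.neg_apply]
  ring

theorem normalizedMean_strictAnti {e s P τ₁ τ₂ : ℝ} (he : 0 < e) (he1 : e < 1) (hs : 0 < s)
    (hP : 0 < P) (hP1 : P ≤ 1) (h0 : 0 ≤ τ₁) (h : τ₁ < τ₂) (h1 : τ₂ ≤ 1) :
    normalizedMean e s P τ₂ < normalizedMean e s P τ₁ := by
  have hD₁ : 0 < τ₁ + (1 - τ₁) * P := by nlinarith [mul_pos hP (by linarith : 0 < 1 - τ₁)]
  have hD : τ₁ + (1 - τ₁) * P ≤ τ₂ + (1 - τ₂) * P := by nlinarith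
  have hN : -τ₂ + (1 - τ₂) * s < -τ₁ + (1 - τ₁) * s := by nlinarith
  have hc : (-τ₂ + (1 - τ₂) * s) * (τ₁ + (1 - τ₁) * P)
      < (-τ₁ + (1 - τ₁) * s) * (τ₂ + (1 - τ₂) * P) := by
    have : 0 < (τ₂ - τ₁) * (P + s) := mul_pos (by linarith) (by linarith)
    nlinarith
  unfold normalizedMean
  generalize -τ₁ + (1 - τ₁) * s = N₁ at *
  generalize -τ₂ + (1 - τ₂) * s = N₂ at *
  generalize τ₁ + (1 - τ₁) * P = D₁ at *
  generalize τ₂ + (1 - τ₂) * P = D₂ at *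
  have hD₂ : 0 < D₂ := by linarith
  rcases le_or_gt 0 N₁ with hN₁ | hN₁
  · calc N₂ / D₂ ^ e < N₁ / D₂ ^ e := by gcongr
      _ ≤ N₁ / D₁ ^ e := by gcongr
  · have key : ∀ D : ℝ, 0 < D → ∀ N : ℝ, N / D ^ e = (N / D) * D ^ (1 - e) := by
      intro D hD N
      rw [Real.rpow_sub hD, Real.rpow_one]; field_simp
    rw [key _ hD₂, key _ hD₁]
    have h2 : N₂ / D₂ < N₁ / D₁ := by rwa [div_lt_div_iff₀ hD₂ hD₁]
    have h3 : D₁ ^ (1 - e) ≤ D₂ ^ (1 - e) :=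
      Real.rpow_le_rpow hD₁.le hD (by linarith)
    have h4 : N₁ / D₁ < 0 := div_neg_of_neg_of_pos hN₁ hD₁
    have h5 : 0 < D₁ ^ (1 - e) := by positivity
    nlinarith

/-- Quasi-concavity in the weight when the second value is negative. -/
theorem lt_normalizedMean_of_between {e s P τ₁ τ₂ τ₃ m : ℝ} (he : 0 < e) (he1 : e < 1)
    (hP : 0 < P) (hm : m < 0) (h0 : 0 ≤ τ₁) (h12 : τ₁ ≤ τ₂) (h23 : τ₂ ≤ τ₃)
    (h3 : τ₃ ≤ 1) (hm1 : m < normalizedMean e s P τ₁) (hm3 : m < normalizedMean e s P τ₃) :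
    m < normalizedMean e s P τ₂ := by
  have hpos : ∀ τ, 0 ≤ τ → τ ≤ 1 → 0 < τ + (1 - τ) * P := by
    intro τ h0 h1
    rcases h0.eq_or_lt with rfl | h0
    · simpa
    · have := mul_nonneg (sub_nonneg.2 h1) hP.le
      linarith
  have hD1 := hpos τ₁ h0 (by linarith)
  have hD2 := hpos τ₂ (by linarith) (by linarith)
  have hD3 := hpos τ₃ (by linarith) h3
  unfold normalizedMean at *
  rw [lt_div_iff₀ (by positivity)] at *
  obtain ⟨a, b, ha, hb, hab, hτ⟩ : τ₂ ∈ segment ℝ τ₁ τ₃ := by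
    rw [segment_eq_Icc (h12.trans h23)]; exact ⟨h12, h23⟩
  simp only [smul_eq_mul] at hτ
  have hconc := (Real.concaveOn_rpow he.le he1.le).2 (mem_Ici.2 hD1.le) (mem_Ici.2 hD3.le) ha hb hab
  simp only [smul_eq_mul] at hconc
  have hb' : b = 1 - a := by linarith
  have e1 : a * (τ₁ + (1 - τ₁) * P) + b * (τ₃ + (1 - τ₃) * P) = τ₂ + (1 - τ₂) * P := by
    rw [← hτ, hb']; ring
  rw [e1] at hconc
  have e2 : -τ₂ + (1 - τ₂) * s
      = a * (-τ₁ + (1 - τ₁) * s) + b * (-τ₃ + (1 - τ₃) * s) := by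
    rw [← hτ, hb']; ring
  rw [e2]
  have h5 : m * (τ₂ + (1 - τ₂) * P) ^ e
      ≤ a * (m * (τ₁ + (1 - τ₁) * P) ^ e) + b * (m * (τ₃ + (1 - τ₃) * P) ^ e) := by nlinarith
  rcases ha.eq_or_lt with rfl | ha
  · have : b = 1 := by linarith
    subst this
    linarith
  · nlinarith [mul_lt_mul_of_pos_left hm1 ha, mul_le_mul_of_nonneg_left hm3.le hb]

theorem StrictMonoOn.Icc_of_Ioo {f : ℝ → ℝ} {a b : ℝ} (hf : ContinuousOn f (Icc a b))
    (h : StrictMonoOn f (Ioo a b)) : StrictMonoOn f (Icc a b) := by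
  have left : ∀ y ∈ Ioo a b, f a < f y := by
    intro y hy
    obtain ⟨z, hz⟩ := exists_between hy.1
    refine lt_of_le_of_lt ?_ (h ⟨hz.1, hz.2.trans hy.2⟩ hy hz.2)
    have ht : Tendsto f (𝓝[>] a) (𝓝 (f a)) :=
      ((hf a ⟨le_rfl, hy.1.le.trans hy.2.le⟩).mono_of_mem_nhdsWithin
        (Icc_mem_nhdsGT (hy.1.trans hy.2)))
    refine le_of_tendsto ht ?_
    filter_upwards [Ioo_mem_nhdsGT hz.1] with w hw
    exact (h ⟨hw.1, hw.2.trans (hz.2.trans hy.2)⟩ ⟨hz.1, hz.2.trans hy.2⟩ hw.2).le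
  have right : ∀ y ∈ Ioo a b, f y < f b := by
    intro y hy
    obtain ⟨z, hz⟩ := exists_between hy.2
    refine (h hy ⟨hy.1.trans hz.1, hz.2⟩ hz.1).trans_le ?_
    have ht : Tendsto f (𝓝[<] b) (𝓝 (f b)) :=
      ((hf b ⟨hy.1.le.trans hy.2.le, le_rfl⟩).mono_of_mem_nhdsWithin
        (Icc_mem_nhdsLT (hy.1.trans hy.2)))
    refine ge_of_tendsto ht ?_
    filter_upwards [Ioo_mem_nhdsLT hz.2] with w hw
    exact (h ⟨hy.1.trans hz.1, hz.2⟩ ⟨(hy.1.trans hz.1).trans hw.1, hw.2⟩ hw.1).le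
  intro x hx y hy hxy
  rcases hx.1.eq_or_lt with rfl | hax
  · rcases hy.2.eq_or_lt with rfl | hyb
    · obtain ⟨z, hz⟩ := exists_between hxy
      exact (left z hz).trans (right z hz)
    · exact left y ⟨hxy, hyb⟩
  · rcases hy.2.eq_or_lt with rfl | hyb
    · exact right x ⟨hax, hxy⟩
    · exact h ⟨hax, hxy.trans hyb⟩ ⟨hax.trans hxy, hyb⟩ hxy

theorem strictMonoOn_Icc_of_eventually_gt {f : ℝ → ℝ} {a b : ℝ} (hf : ContinuousOn f (Icc a b))
    (h : ∀ x ∈ Ioo a b, ∀ᶠ z in 𝓝[>] x, f x < f z) : StrictMonoOn f (Icc a b) := by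
  refine StrictMonoOn.Icc_of_Ioo hf fun x hx y hy hxy => ?_
  obtain ⟨m, hm, hmax⟩ := isCompact_Icc.exists_isMaxOn (nonempty_Icc.2 hxy.le)
    (hf.mono (Icc_subset_Icc hx.1.le hy.2.le))
  have hmy : m = y := by
    by_contra hne
    have hmlt : m < y := lt_of_le_of_ne hm.2 hne
    obtain ⟨z, hz1, hz2⟩ := ((h m ⟨hx.1.trans_le hm.1, hmlt.trans hy.2⟩).and
      (Ioo_mem_nhdsGT hmlt)).exists
    exact absurd (hmax ⟨hm.1.trans hz2.1.le, hz2.2.le⟩) (not_le.2 hz1)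
  subst hmy
  obtain ⟨z, hz1, hz2⟩ := ((h x hx).and (Ioo_mem_nhdsGT hxy)).exists
  exact hz1.trans_le (hmax ⟨hz2.1.le, hz2.2.le⟩)

section PowerInequalities

variable {p x : ℝ}

theorem rpow_sub_one_eq_mul_rpow_sub_two (hx : 0 < x) : x ^ (p - 1) = x * x ^ (p - 2) := by
  rw [show p - 1 = p - 2 + 1 by ring, Real.rpow_add_one hx.ne', mul_comm]

theorem rpow_eq_sq_mul_rpow_sub_two (hx : 0 < x) : x ^ p = x ^ 2 * x ^ (p - 2) := by
  rw [← Real.rpow_natCast, ← Real.rpow_add hx]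
  norm_num

theorem hasDerivAt_rpow_sub_one (hx : 0 < x) :
    HasDerivAt (fun t : ℝ => t ^ (p - 1)) ((p - 1) * x ^ (p - 2)) x := by
  have := Real.hasDerivAt_rpow_const (x := x) (p := p - 1) (Or.inl hx.ne')
  rwa [show p - 1 - 1 = p - 2 by ring] at this

theorem hasDerivAt_rpow_sub_two (hx : 0 < x) :
    HasDerivAt (fun t : ℝ => t ^ (p - 2)) ((p - 2) * x ^ (p - 2) / x) x := by
  have := Real.hasDerivAt_rpow_const (x := x) (p := p - 2) (Or.inl hx.ne')
  rwa [Real.rpow_sub_one hx.ne', ← mul_div_assoc] at this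

theorem hasDerivAt_rpow_self (hx : 0 < x) :
    HasDerivAt (fun t : ℝ => t ^ p) (p * (x * x ^ (p - 2))) x := by
  have := Real.hasDerivAt_rpow_const (x := x) (p := p) (Or.inl hx.ne')
  rwa [rpow_sub_one_eq_mul_rpow_sub_two hx] at this

theorem mul_rpow_sub_two_lt_one (hp : 2 < p) (hx : 0 < x) (hx1 : x < 1) :
    x * x ^ (p - 2) < 1 := by
  have := Real.rpow_lt_one hx.le hx1 (by linarith : 0 < p - 2)
  have : 0 < x ^ (p - 2) := by positivity
  nlinarith

theorem phi_of_pos (hx : 0 < x) : phi p x = x ^ (p - 1) := by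
  rw [phi, abs_of_pos hx, rpow_sub_one_eq_mul_rpow_sub_two hx]

theorem phi_neg_of_pos (hx : 0 < x) : phi p (-x) = -x ^ (p - 1) := by
  rw [phi, abs_neg, abs_of_pos hx, rpow_sub_one_eq_mul_rpow_sub_two hx, neg_mul]

theorem neg_one_lt_phi (hp : 2 < p) (hx : -1 < x) : -1 < phi p x := by
  rcases le_or_gt 0 x with h | h
  · have : 0 ≤ phi p x := by unfold phi; positivity
    linarith
  · obtain ⟨y, rfl⟩ : ∃ y, x = -y := ⟨-x, by ring⟩
    rw [phi_neg_of_pos (by linarith), neg_lt_neg_iff]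
    exact Real.rpow_lt_one (by linarith) (by linarith) (by linarith)

theorem continuous_phi (hp : 2 < p) : Continuous (phi p) := by
  unfold phi
  exact continuous_id.mul (continuous_abs.rpow_const fun _ => Or.inr (by linarith))

theorem lam_of_pos (hx : 0 < x) : lam p x = 1 / (1 + x) - (p - 1) / (1 + x ^ (p - 1)) := by
  rw [lam, if_neg (by linarith), phi_of_pos hx]

theorem lam_neg_of_pos (hx : 0 < x) (hx1 : x < 1) :
    lam p (-x) = 1 / (1 - x) - (p - 1) / (1 - x ^ (p - 1)) := by
  rw [lam, if_neg (by intro h; linarith), phi_neg_of_pos hx, ← sub_eq_add_neg, ← sub_eq_add_neg]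

theorem continuousOn_lam (hp : 2 < p) : ContinuousOn (lam p) (Ioi (-1)) := by
  have : ContinuousOn (fun R => 1 / (1 + R) - (p - 1) / (1 + phi p R)) (Ioi (-1)) := by
    refine ContinuousOn.sub ?_ ?_
    · refine continuousOn_const.div (by fun_prop) fun x hx => ?_
      have : -1 < x := hx
      linarith
    · refine continuousOn_const.div (continuous_const.add (continuous_phi hp)).continuousOn ?_
      intro x hx
      have := neg_one_lt_phi hp hx
      linarith
  refine this.congr fun x hx => ?_
  rw [lam, if_neg (ne_of_gt hx)]

theorem hasDerivAt_lam (hx : 0 < x) :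
    HasDerivAt (lam p)
      (-1 / (1 + x) ^ 2 + (p - 1) ^ 2 * x ^ (p - 2) / (1 + x ^ (p - 1)) ^ 2) x := by
  have hpos : 0 < x ^ (p - 1) := by positivity
  have h1 : HasDerivAt (fun t : ℝ => 1 / (1 + t) - (p - 1) / (1 + t ^ (p - 1)))
      (-1 / (1 + x) ^ 2 + (p - 1) ^ 2 * x ^ (p - 2) / (1 + x ^ (p - 1)) ^ 2) x := by
    refine (((hasDerivAt_const x (1 : ℝ)).div ((hasDerivAt_id x).const_add 1)
      (by simp; linarith)).sub
      ((hasDerivAt_const x (p - 1)).div ((hasDerivAt_rpow_sub_one hx).const_add 1)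
        (by positivity))).congr_deriv ?_
    simp only [id]
    field_simp
    ring
  refine h1.congr_of_eventuallyEq ?_
  filter_upwards [lt_mem_nhds hx] with t ht using lam_of_pos ht

theorem hasDerivAt_lam_comp_neg (hp : 2 < p) (hx : 0 < x) (hx1 : x < 1) :
    HasDerivAt (fun t => lam p (-t))
      (1 / (1 - x) ^ 2 - (p - 1) ^ 2 * x ^ (p - 2) / (1 - x ^ (p - 1)) ^ 2) x := by
  have hpos : x ^ (p - 1) < 1 := Real.rpow_lt_one hx.le hx1 (by linarith)
  have h1 : HasDerivAt (fun t : ℝ => 1 / (1 - t) - (p - 1) / (1 - t ^ (p - 1)))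
      (1 / (1 - x) ^ 2 - (p - 1) ^ 2 * x ^ (p - 2) / (1 - x ^ (p - 1)) ^ 2) x := by
    have e1 : 1 - x ≠ 0 := by linarith
    have e2 : 1 - x ^ (p - 1) ≠ 0 := by linarith
    refine (((hasDerivAt_const x (1 : ℝ)).div ((hasDerivAt_id x).const_sub 1) e1).sub
      ((hasDerivAt_const x (p - 1)).div ((hasDerivAt_rpow_sub_one hx).const_sub 1)
        e2)).congr_deriv ?_
    simp only [id]
    field_simp
    ring
  refine h1.congr_of_eventuallyEq ?_
  filter_upwards [lt_mem_nhds hx, gt_mem_nhds hx1] with t ht ht1 using lam_neg_of_pos ht ht1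

/-- The function whose comparison with `(p - 1) ^ 2` decides the sign of the derivative of `lam`. -/
theorem strictAntiOn_critical_ratio (hp : 2 < p) :
    StrictAntiOn (fun t : ℝ => (1 + t ^ (p - 1)) ^ 2 / ((1 + t) ^ 2 * t ^ (p - 2))) (Ioc 0 1) := by
  have hd : ∀ x : ℝ, 0 < x → HasDerivAt
      (fun t : ℝ => (1 + t ^ (p - 1)) ^ 2 / ((1 + t) ^ 2 * t ^ (p - 2)))
      (-(1 + x * x ^ (p - 2)) * (p * x * (1 - x ^ (p - 2)) + (p - 2) * (1 - x ^ 2 * x ^ (p - 2)))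
        / (x * (1 + x) ^ 3 * x ^ (p - 2))) x := by
    intro x hx
    have hw : 0 < x ^ (p - 2) := by positivity
    have h1 := (((hasDerivAt_rpow_sub_one (p := p) hx).const_add 1).pow 2).div
      ((((hasDerivAt_id x).const_add 1).pow 2).mul (hasDerivAt_rpow_sub_two (p := p) hx))
      (by simp; exact ⟨by linarith, hw.ne'⟩)
    refine h1.congr_deriv ?_
    simp only [Pi.mul_apply, Pi.pow_apply, id, rpow_sub_one_eq_mul_rpow_sub_two hx]
    generalize x ^ (p - 2) = w at *
    field_simp
    ring
  refine strictAntiOn_of_hasDerivWithinAt_neg (convex_Ioc 0 1)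
    (fun x hx => (hd x hx.1).continuousAt.continuousWithinAt)
    (fun x hx => (hd x (interior_subset hx).1).hasDerivWithinAt) ?_
  intro x hx
  rw [interior_Ioc] at hx
  have hx0 := hx.1
  have hw : 0 < x ^ (p - 2) := by positivity
  have hw1 : x ^ (p - 2) < 1 := Real.rpow_lt_one hx.1.le hx.2 (by linarith)
  refine div_neg_of_neg_of_pos ?_ (by positivity)
  have h1 : 0 < p * x * (1 - x ^ (p - 2)) :=
    mul_pos (mul_pos (by linarith) hx.1) (by linarith)
  have h2 : x ^ 2 * x ^ (p - 2) < 1 := by nlinarith [hx.1, hx.2]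
  have h3 : 0 < (p - 2) * (1 - x ^ 2 * x ^ (p - 2)) := mul_pos (by linarith) (by linarith)
  have h4 : 0 < 1 + x * x ^ (p - 2) := by positivity
  nlinarith [mul_pos h4 (add_pos h1 h3)]

theorem critical_ratio_eq {R₀ : ℝ} (h0 : 0 < R₀)
    (h : R₀ ^ ((p - 1) / 2) + R₀ ^ (-((p - 1) / 2))
      = (p - 1) * (R₀ ^ ((1 : ℝ) / 2) + R₀ ^ (-(1 : ℝ) / 2))) :
    (1 + R₀ ^ (p - 1)) ^ 2 / ((1 + R₀) ^ 2 * R₀ ^ (p - 2)) = (p - 1) ^ 2 := by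
  have hs : 0 < R₀ ^ ((1 : ℝ) / 2) := by positivity
  have hm : 0 < R₀ ^ ((p - 1) / 2) := by positivity
  have e1 : R₀ = R₀ ^ ((1 : ℝ) / 2) * R₀ ^ ((1 : ℝ) / 2) := by
    rw [← Real.rpow_add h0]; norm_num
  have e2 : R₀ ^ (p - 1) = R₀ ^ ((p - 1) / 2) * R₀ ^ ((p - 1) / 2) := by
    rw [← Real.rpow_add h0]; ring_nf
  have e3 : R₀ ^ (p - 2) = R₀ ^ (p - 1) / R₀ := by
    rw [← Real.rpow_sub_one h0.ne']; ring_nf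
  rw [show -(1 : ℝ) / 2 = -(1 / 2) by norm_num, Real.rpow_neg h0.le, Real.rpow_neg h0.le] at h
  rw [e3, e2]
  generalize R₀ ^ ((1 : ℝ) / 2) = s at *
  generalize R₀ ^ ((p - 1) / 2) = m at *
  subst e1
  have h' : s * (1 + m * m) = (p - 1) * m * (1 + s * s) := by
    field_simp at h
    linarith
  field_simp
  linear_combination (s * (1 + m * m) + (p - 1) * m * (1 + s * s)) * h'

end PowerInequalities

section LamMonotonicity

variable {p : ℝ}

theorem one_sub_rpow_le {n x : ℝ} (hn : 1 ≤ n) (hx : 0 ≤ x) : 1 - x ^ n ≤ n * (1 - x) := by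
  have := one_add_mul_self_le_rpow_one_add (s := x - 1) (by linarith) hn
  rw [show 1 + (x - 1) = x by ring] at this
  linarith

theorem strictMonoOn_lam {R₀ : ℝ} (hp : 2 < p) (h0 : 0 < R₀) (h1 : R₀ < 1)
    (h : (1 + R₀ ^ (p - 1)) ^ 2 / ((1 + R₀) ^ 2 * R₀ ^ (p - 2)) = (p - 1) ^ 2) :
    StrictMonoOn (lam p) (Icc R₀ 1) := by
  have hpos : ∀ x ∈ Icc R₀ 1, 0 < x := fun x hx => h0.trans_le hx.1
  refine strictMonoOn_of_hasDerivWithinAt_pos (convex_Icc R₀ 1)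
    (fun x hx => (hasDerivAt_lam (hpos x hx)).continuousAt.continuousWithinAt)
    (fun x hx => (hasDerivAt_lam (hpos x (interior_subset hx))).hasDerivWithinAt) ?_
  intro x hx
  rw [interior_Icc] at hx
  have hx0 : 0 < x := h0.trans hx.1
  have := strictAntiOn_critical_ratio hp ⟨h0, h1.le⟩ ⟨hx0, hx.2.le⟩ hx.1
  simp only [h] at this
  rw [div_lt_iff₀ (by positivity)] at this
  have e : -1 / (1 + x) ^ 2 + (p - 1) ^ 2 * x ^ (p - 2) / (1 + x ^ (p - 1)) ^ 2
      = ((p - 1) ^ 2 * ((1 + x) ^ 2 * x ^ (p - 2)) - (1 + x ^ (p - 1)) ^ 2)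
        / ((1 + x) ^ 2 * (1 + x ^ (p - 1)) ^ 2) := by
    field_simp
    ring
  rw [e]
  exact div_pos (by linarith) (by positivity)

theorem antitoneOn_lam {R₀ : ℝ} (hp : 2 < p) (h0 : 0 < R₀) (h1 : R₀ < 1)
    (h : (1 + R₀ ^ (p - 1)) ^ 2 / ((1 + R₀) ^ 2 * R₀ ^ (p - 2)) = (p - 1) ^ 2) :
    AntitoneOn (lam p) (Ioc 0 R₀) := by
  refine antitoneOn_of_hasDerivWithinAt_nonpos (convex_Ioc 0 R₀)
    (fun x hx => (hasDerivAt_lam hx.1).continuousAt.continuousWithinAt)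
    (fun x hx => (hasDerivAt_lam (interior_subset hx).1).hasDerivWithinAt) ?_
  intro x hx
  rw [interior_Ioc] at hx
  have hx0 : 0 < x := hx.1
  have := strictAntiOn_critical_ratio hp ⟨hx0, hx.2.le.trans h1.le⟩ ⟨h0, h1.le⟩ hx.2
  simp only [h] at this
  rw [lt_div_iff₀ (by positivity)] at this
  have e : -1 / (1 + x) ^ 2 + (p - 1) ^ 2 * x ^ (p - 2) / (1 + x ^ (p - 1)) ^ 2
      = ((p - 1) ^ 2 * ((1 + x) ^ 2 * x ^ (p - 2)) - (1 + x ^ (p - 1)) ^ 2)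
        / ((1 + x) ^ 2 * (1 + x ^ (p - 1)) ^ 2) := by
    field_simp
    ring
  rw [e]
  exact div_nonpos_of_nonpos_of_nonneg (by linarith) (by positivity)

theorem mul_rpow_half_le_one_sub_rpow (hp : 2 < p) {x : ℝ} (hx : 0 < x) (hx1 : x ≤ 1) :
    (p - 1) * (1 - x) * x ^ ((p - 2) / 2) ≤ 1 - x ^ (p - 1) := by
  have hd : ∀ x : ℝ, 0 < x → HasDerivAt
      (fun t : ℝ => 1 - t ^ (p - 1) - (p - 1) * (1 - t) * t ^ ((p - 2) / 2))
      ((p - 1) * (x ^ ((p - 2) / 2) / x)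
        * (p / 2 * x - x * x ^ ((p - 2) / 2) - (p - 2) / 2)) x := by
    intro x hx
    have h1 := ((hasDerivAt_rpow_sub_one (p := p) hx).const_sub 1).sub
      ((((hasDerivAt_id x).const_sub 1).const_mul (p - 1)).mul
        (Real.hasDerivAt_rpow_const (x := x) (p := (p - 2) / 2) (Or.inl hx.ne')))
    refine h1.congr_deriv ?_
    have e : x ^ (p - 2) = x ^ ((p - 2) / 2) * x ^ ((p - 2) / 2) := by
      rw [← Real.rpow_add hx]; ring_nf
    rw [e, Real.rpow_sub_one hx.ne']
    simp only [id]
    field_simp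
    ring
  have hanti : AntitoneOn
      (fun t : ℝ => 1 - t ^ (p - 1) - (p - 1) * (1 - t) * t ^ ((p - 2) / 2)) (Ioc 0 1) := by
    refine antitoneOn_of_hasDerivWithinAt_nonpos (convex_Ioc 0 1)
      (fun x hx => (hd x hx.1).continuousAt.continuousWithinAt)
      (fun x hx => (hd x (interior_subset hx).1).hasDerivWithinAt) ?_
    intro x hx
    have hx0 := (interior_subset hx).1
    refine mul_nonpos_of_nonneg_of_nonpos
      (mul_nonneg (by linarith) (by positivity)) ?_
    have := one_sub_rpow_le (n := p / 2) (by linarith) hx0.le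
    rw [show p / 2 = (p - 2) / 2 + 1 by ring, Real.rpow_add_one hx0.ne'] at this
    linarith
  have := hanti ⟨hx, hx1⟩ ⟨one_pos, le_rfl⟩ hx1
  simp only [Real.one_rpow] at this
  linarith

theorem deriv_lam_comp_neg_nonneg (hp : 2 < p) {x : ℝ} (hx0 : 0 < x) (hx1 : x < 1) :
    0 ≤ 1 / (1 - x) ^ 2 - (p - 1) ^ 2 * x ^ (p - 2) / (1 - x ^ (p - 1)) ^ 2 := by
  have h := mul_rpow_half_le_one_sub_rpow hp hx0 hx1.le
  have hlt : x ^ (p - 1) < 1 := Real.rpow_lt_one hx0.le hx1 (by linarith)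
  have e : x ^ (p - 2) = (x ^ ((p - 2) / 2)) ^ 2 := by
    rw [sq, ← Real.rpow_add hx0]; ring_nf
  rw [e, sub_nonneg, div_le_div_iff₀ (by nlinarith) (by nlinarith), one_mul]
  have h0 : 0 ≤ (p - 1) * (1 - x) * x ^ ((p - 2) / 2) :=
    mul_nonneg (mul_nonneg (by linarith) (by linarith)) (by positivity)
  have := pow_le_pow_left₀ h0 h 2
  linarith

theorem monotoneOn_lam_comp_neg (hp : 2 < p) : MonotoneOn (fun t => lam p (-t)) (Ioo 0 1) := by
  refine monotoneOn_of_hasDerivWithinAt_nonneg (convex_Ioo 0 1)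
    (fun x hx => (hasDerivAt_lam_comp_neg hp hx.1 hx.2).continuousAt.continuousWithinAt)
    (fun x hx => (hasDerivAt_lam_comp_neg hp (interior_subset hx).1
      (interior_subset hx).2).hasDerivWithinAt) ?_
  intro x hx
  obtain ⟨hx0, hx1⟩ := interior_subset hx
  exact deriv_lam_comp_neg_nonneg hp hx0 hx1

theorem lam_neg_add_pos (hp : 2 < p) {x : ℝ} (hx : 0 < x) (hx1 : x < 1) :
    0 < p - 2 + lam p (-x) := by
  have hlt : x ^ (p - 1) < 1 := Real.rpow_lt_one hx.le hx1 (by linarith)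
  have hw : 0 < x ^ (p - 2) := by positivity
  have hB := one_add_mul_self_lt_rpow_one_add (s := x⁻¹ - 1) (p := p - 1)
    (by have := inv_pos.2 hx; linarith) (by have := (one_lt_inv₀ hx).2 hx1; linarith)
    (by linarith)
  rw [add_sub_cancel, Real.inv_rpow hx.le] at hB
  rw [lam_neg_of_pos hx hx1]
  rw [rpow_sub_one_eq_mul_rpow_sub_two hx] at *
  have e : p - 2 + (1 / (1 - x) - (p - 1) / (1 - x * x ^ (p - 2)))
      = x * (1 - x * x ^ (p - 2) - (p - 1) * x ^ (p - 2) * (1 - x))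
        / ((1 - x) * (1 - x * x ^ (p - 2))) := by
    have : 1 - x ≠ 0 := by linarith
    have : 1 - x * x ^ (p - 2) ≠ 0 := by linarith
    field_simp
    ring
  rw [e]
  refine div_pos (mul_pos hx ?_) (mul_pos (by linarith) (by linarith))
  field_simp at hB
  linarith

theorem lam_add_eq {x : ℝ} (hx : 0 < x) :
    p - 2 + lam p x = x * ((p - 1) * (1 + x) * x ^ (p - 2) - (1 + x * x ^ (p - 2)))
      / ((1 + x) * (1 + x * x ^ (p - 2))) := by
  rw [lam_of_pos hx, rpow_sub_one_eq_mul_rpow_sub_two hx]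
  have : 0 < x ^ (p - 2) := by positivity
  field_simp
  ring

end LamMonotonicity

section Coefficients

variable {p : ℝ}

/-- Along `τ * posCoeff p x = const` the first coordinate of `η` is antitone in `x`. -/
noncomputable def posCoeff (p x : ℝ) : ℝ := (1 / p + x ^ (p - 1) + (p - 1) / p * x ^ p) / x ^ p

/-- Along `τ * negCoeff p x = const` the second coordinate of `η` at `R = -x` is antitone in `x`. -/
noncomputable def negCoeff (p x : ℝ) : ℝ := ((p - 1) / p - x + x ^ p / p) / x ^ p

theorem posCoeff_pos (hp : 2 < p) {x : ℝ} (hx : 0 < x) : 0 < posCoeff p x := by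
  have : 0 < (p - 1) / p := div_pos (by linarith) (by linarith)
  have : 0 < p := by linarith
  unfold posCoeff
  positivity

theorem hasDerivAt_posCoeff (hp : 2 < p) {x : ℝ} (hx : 0 < x) :
    HasDerivAt (posCoeff p) (-(1 + x * x ^ (p - 2)) / (x ^ 3 * x ^ (p - 2))) x := by
  have h0 : p ≠ 0 := by linarith
  have hw : 0 < x ^ (p - 2) := by positivity
  refine ((((hasDerivAt_rpow_sub_one hx).const_add (1 / p)).add
    ((hasDerivAt_rpow_self hx).const_mul ((p - 1) / p))).div (hasDerivAt_rpow_self hx)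
    (by positivity)).congr_deriv ?_
  simp only [Pi.add_apply, rpow_sub_one_eq_mul_rpow_sub_two hx,
    rpow_eq_sq_mul_rpow_sub_two (p := p) hx]
  field_simp
  ring

theorem hasDerivAt_negCoeff (hp : 2 < p) {x : ℝ} (hx : 0 < x) :
    HasDerivAt (negCoeff p) (-((p - 1) * (1 - x)) / (x ^ 3 * x ^ (p - 2))) x := by
  have h0 : p ≠ 0 := by linarith
  have hw : 0 < x ^ (p - 2) := by positivity
  refine ((((hasDerivAt_id x).const_sub ((p - 1) / p)).add
    ((hasDerivAt_rpow_self hx).div_const p)).div (hasDerivAt_rpow_self hx)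
    (by positivity)).congr_deriv ?_
  simp only [Pi.add_apply, rpow_eq_sq_mul_rpow_sub_two (p := p) hx, id]
  field_simp
  ring

theorem negCoeff_strictAntiOn (hp : 2 < p) : StrictAntiOn (negCoeff p) (Ioc 0 1) := by
  refine strictAntiOn_of_hasDerivWithinAt_neg (convex_Ioc 0 1)
    (fun x hx => (hasDerivAt_negCoeff hp hx.1).continuousAt.continuousWithinAt)
    (fun x hx => (hasDerivAt_negCoeff hp (interior_subset hx).1).hasDerivWithinAt) ?_
  intro x hx
  rw [interior_Ioc] at hx
  have hx0 := hx.1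
  refine div_neg_of_neg_of_pos ?_ (by positivity)
  rw [neg_lt_zero]
  exact mul_pos (by linarith) (by linarith [hx.2])

theorem posCoeff_antitoneOn (hp : 2 < p) : AntitoneOn (posCoeff p) (Ioi 0) := by
  refine antitoneOn_of_hasDerivWithinAt_nonpos (convex_Ioi 0)
    (fun x hx => (hasDerivAt_posCoeff hp hx).continuousAt.continuousWithinAt)
    (fun x hx => (hasDerivAt_posCoeff hp (interior_subset hx)).hasDerivWithinAt) ?_
  intro x hx
  have hx0 : 0 < x := interior_subset hx
  refine div_nonpos_of_nonpos_of_nonneg ?_ (by positivity)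
  have : 0 < x * x ^ (p - 2) := by positivity
  linarith

theorem negCoeff_pos (hp : 2 < p) {x : ℝ} (hx : 0 < x) (hx1 : x < 1) : 0 < negCoeff p x := by
  have h := negCoeff_strictAntiOn hp ⟨hx, hx1.le⟩ ⟨one_pos, le_rfl⟩ hx1
  have : negCoeff p 1 = 0 := by
    have : p ≠ 0 := by linarith
    unfold negCoeff
    simp only [Real.one_rpow]
    field_simp
    ring
  rwa [this] at h

theorem two_mul_negCoeff_le (hp : 2 < p) {x : ℝ} (hx : 0 < x) (hx1 : x ≤ 1) :
    2 * negCoeff p x * (x ^ 2 * x ^ (p - 2)) ≤ (p - 1) * (1 - x) ^ 2 := by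
  have h0 : p ≠ 0 := by linarith
  have hd : ∀ x : ℝ, 0 < x → HasDerivAt
      (fun t : ℝ => (p - 1) * (1 - t) ^ 2 - 2 * ((p - 1) / p - t + t ^ p / p))
      (2 * (1 - x ^ (p - 1)) - 2 * ((p - 1) * (1 - x))) x := by
    intro x hx
    refine (((((hasDerivAt_id x).const_sub 1).pow 2).const_mul (p - 1)).sub
      ((((hasDerivAt_id x).const_sub ((p - 1) / p)).add
        ((hasDerivAt_rpow_self hx).div_const p)).const_mul 2)).congr_deriv ?_
    simp only [id, rpow_sub_one_eq_mul_rpow_sub_two hx]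
    field_simp
    ring
  have hanti : AntitoneOn
      (fun t : ℝ => (p - 1) * (1 - t) ^ 2 - 2 * ((p - 1) / p - t + t ^ p / p)) (Ioc 0 1) := by
    refine antitoneOn_of_hasDerivWithinAt_nonpos (convex_Ioc 0 1)
      (fun x hx => (hd x hx.1).continuousAt.continuousWithinAt)
      (fun x hx => (hd x (interior_subset hx).1).hasDerivWithinAt) ?_
    intro x hx
    have := one_sub_rpow_le (n := p - 1) (by linarith) (interior_subset hx).1.le
    linarith
  have := hanti ⟨hx, hx1⟩ ⟨one_pos, le_rfl⟩ hx1
  simp only [Real.one_rpow] at this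
  have e : (p - 1) / p - 1 + 1 / p = 0 := by field_simp; ring
  have e2 : negCoeff p x * (x ^ 2 * x ^ (p - 2)) = (p - 1) / p - x + x ^ p / p := by
    rw [← rpow_eq_sq_mul_rpow_sub_two hx, negCoeff, div_mul_cancel₀]
    positivity
  rw [e] at this
  linarith

end Coefficients

section CoefficientProducts

variable {p : ℝ}

theorem one_half_le_of_le_rpow_sub_two (hp : 4 ≤ p) {x : ℝ} (hx : 0 < x)
    (h : 1 + x * x ^ (p - 2) ≤ (p - 1) * (1 + x) * x ^ (p - 2)) : 1 / 2 ≤ x := by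
  by_contra! hlt
  have hw : 0 < x ^ (p - 2) := by positivity
  have h1 : x ^ (p - 2) ≤ (1 / 2 : ℝ) ^ (p - 2) :=
    Real.rpow_le_rpow hx.le hlt.le (by linarith)
  have h2 : (p * 3 / 2 - 2) * (1 / 2 : ℝ) ^ (p - 2) ≤ 1 := by
    have e : (1 / 2 : ℝ) ^ (p - 2) = 1 / (4 * (2 : ℝ) ^ (p - 4)) := by
      rw [one_div, Real.inv_rpow (by norm_num), show p - 2 = 2 + (p - 4) by ring,
        Real.rpow_add (by norm_num)]
      norm_num
    have h3 : 1 + (p - 4) * Real.log 2 ≤ (2 : ℝ) ^ (p - 4) := by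
      rw [Real.rpow_def_of_pos (by norm_num)]
      have := Real.add_one_le_exp (Real.log 2 * (p - 4))
      linarith
    have h4 := Real.log_two_gt_d9
    rw [e, mul_one_div, div_le_one (by positivity)]
    nlinarith
  have h5 : (p - 1) * (1 + x) * x ^ (p - 2) - x * x ^ (p - 2)
      < (p * 3 / 2 - 2) * x ^ (p - 2) := by
    nlinarith [mul_pos hw (mul_pos (by linarith : 0 < p - 2) (by linarith : 0 < 1 / 2 - x))]
  have h6 : (p * 3 / 2 - 2) * x ^ (p - 2) ≤ (p * 3 / 2 - 2) * (1 / 2 : ℝ) ^ (p - 2) :=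
    mul_le_mul_of_nonneg_left h1 (by linarith)
  linarith

theorem mul_le_four_mul_posCoeff (hp : 2 < p) {x : ℝ} (hx : 0 < x) (hx1 : x ≤ 1)
    (h : 1 + x * x ^ (p - 2) ≤ (p - 1) * (1 + x) * x ^ (p - 2)) :
    x ^ (p - 2) * (1 + x) * (1 + x * x ^ (p - 2))
      ≤ 4 * (posCoeff p x * (x ^ 2 * x ^ (p - 2))) := by
  have hw : 0 < x ^ (p - 2) := by positivity
  have hw1 : x ^ (p - 2) ≤ 1 := Real.rpow_le_one hx.le hx1 (by linarith)
  have hhalf := fun hp4 : 4 ≤ p => one_half_le_of_le_rpow_sub_two hp4 hx h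
  have e : posCoeff p x * (x ^ 2 * x ^ (p - 2))
      = 1 / p + x * x ^ (p - 2) + (p - 1) / p * (x ^ 2 * x ^ (p - 2)) := by
    rw [← rpow_eq_sq_mul_rpow_sub_two hx, ← rpow_sub_one_eq_mul_rpow_sub_two hx, posCoeff,
      div_mul_cancel₀]
    positivity
  rw [e, show (p - 1) / p = 1 - 1 / p by field_simp]
  clear e h
  generalize x ^ (p - 2) = w at *
  have hxw : 0 < x * w := by positivity
  have hi : 0 < 1 / p := by positivity
  rcases le_or_gt p 4 with hp4 | hp4
  · have hi1 : 1 / 4 ≤ 1 / p := one_div_le_one_div_of_le (by linarith) hp4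
    have hi2 : 1 / p ≤ 1 / 2 := one_div_le_one_div_of_le (by norm_num) hp.le
    nlinarith [mul_le_mul_of_nonneg_left hw1 hxw.le, mul_le_mul_of_nonneg_left hx1 hxw.le,
      mul_le_mul_of_nonneg_left hw1 (mul_pos hxw hx).le, mul_pos hxw hx,
      mul_nonneg (mul_pos hxw hx).le (sub_nonneg.2 hi2)]
  · have hx2 := hhalf hp4.le
    have hi2 : 1 / p ≤ 1 / 4 := one_div_le_one_div_of_le (by norm_num) hp4.le
    nlinarith [mul_le_mul_of_nonneg_left hw1 hxw.le, mul_le_mul_of_nonneg_left hx1 hxw.le,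
      mul_le_mul_of_nonneg_left hw1 (mul_pos hxw hx).le, mul_pos hxw hx,
      mul_nonneg (mul_pos hxw hx).le (sub_nonneg.2 hi2), mul_le_mul_of_nonneg_left hx2 hw.le]

theorem monotoneOn_posCoeff_mul_sq (hp : 2 < p) {x₁ x₂ : ℝ} (hx₂ : 0 < x₂) (hx₁ : x₁ ≤ 1)
    (hlam : ∀ x ∈ Icc x₂ x₁, 0 ≤ p - 2 + lam p x) :
    MonotoneOn (fun x => posCoeff p x * (p - 2 + lam p x) ^ 2) (Icc x₂ x₁) := by
  have hd := fun (x : ℝ) (hx : 0 < x) => (hasDerivAt_posCoeff hp hx).mul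
    (((hasDerivAt_lam (p := p) hx).const_add (p - 2)).pow 2)
  refine monotoneOn_of_hasDerivWithinAt_nonneg (convex_Icc x₂ x₁)
    (fun x hx => (hd x (hx₂.trans_le hx.1)).continuousAt.continuousWithinAt)
    (fun x hx => (hd x (hx₂.trans_le (interior_subset hx).1)).hasDerivWithinAt) ?_
  intro x hx
  have hx' := interior_subset hx
  have hx0 : 0 < x := hx₂.trans_le hx'.1
  have hx1 : x ≤ 1 := hx'.2.trans hx₁
  have hL := hlam x hx'
  have hw : 0 < x ^ (p - 2) := by positivity
  have hw1 : x ^ (p - 2) ≤ 1 := Real.rpow_le_one hx0.le hx1 (by linarith)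
  have hK : 0 ≤ (p - 1) * (1 + x) * x ^ (p - 2) - (1 + x * x ^ (p - 2)) := by
    rw [lam_add_eq hx0] at hL
    by_contra! hneg
    exact absurd hL (not_le.2 (div_neg_of_neg_of_pos (mul_neg_of_pos_of_neg hx0 hneg)
      (by positivity)))
  have hkey := mul_le_four_mul_posCoeff hp hx0 hx1 (by linarith)
  suffices 0 ≤ (-(1 + x * x ^ (p - 2)) / (x ^ 3 * x ^ (p - 2))) * (p - 2 + lam p x)
      + 2 * posCoeff p x *
        (-1 / (1 + x) ^ 2 + (p - 1) ^ 2 * x ^ (p - 2) / (1 + x ^ (p - 1)) ^ 2) by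
    have := mul_nonneg hL this
    simp only [Pi.pow_apply]
    push_cast
    linarith
  rw [lam_add_eq hx0, rpow_sub_one_eq_mul_rpow_sub_two hx0]
  generalize posCoeff p x = C at *
  generalize x ^ (p - 2) = w at *
  have e : (-(1 + x * w) / (x ^ 3 * w))
        * (x * ((p - 1) * (1 + x) * w - (1 + x * w)) / ((1 + x) * (1 + x * w)))
      + 2 * C * (-1 / (1 + x) ^ 2 + (p - 1) ^ 2 * w / (1 + x * w) ^ 2)
      = (2 * (C * (x ^ 2 * w)) * (w * ((p - 1) ^ 2 * w * (1 + x) ^ 2 - (1 + x * w) ^ 2))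
        - w * ((p - 1) * (1 + x) * w - (1 + x * w)) * (1 + x) * (1 + x * w) ^ 2)
        / (x ^ 2 * w ^ 2 * (1 + x) ^ 2 * (1 + x * w) ^ 2) := by
    field_simp
    ring
  rw [e]
  refine div_nonneg ?_ (by positivity)
  set K := (p - 1) * (1 + x) * w - (1 + x * w) with hKdef
  set E := C * (x ^ 2 * w)
  have hE : 0 ≤ E := by
    have : 0 < w * (1 + x) * (1 + x * w) := by positivity
    linarith
  have h1 : K * (2 * (1 + x * w)) ≤ w * ((p - 1) ^ 2 * w * (1 + x) ^ 2 - (1 + x * w) ^ 2) := by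
    have e2 : w * ((p - 1) ^ 2 * w * (1 + x) ^ 2 - (1 + x * w) ^ 2)
        = K * (2 * (1 + x * w)) + K ^ 2 + (1 - w) * (1 + x * w) ^ 2 := by
      rw [hKdef]; ring
    rw [e2]
    have := mul_nonneg (sub_nonneg.2 hw1) (sq_nonneg (1 + x * w))
    nlinarith [sq_nonneg K]
  have h2 := mul_le_mul_of_nonneg_left h1 hE
  have h3 := mul_le_mul_of_nonneg_left hkey
    (mul_nonneg hK (by positivity : 0 ≤ 1 + x * w))
  linarith

theorem antitoneOn_negCoeff_mul_sq (hp : 2 < p) :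
    AntitoneOn (fun x => negCoeff p x * (p - 2 + lam p (-x)) ^ 2) (Ioo 0 1) := by
  have hd := fun (x : ℝ) (hx : x ∈ Ioo 0 1) => (hasDerivAt_negCoeff hp hx.1).mul
    (((hasDerivAt_lam_comp_neg hp hx.1 hx.2).const_add (p - 2)).pow 2)
  refine antitoneOn_of_hasDerivWithinAt_nonpos (convex_Ioo 0 1)
    (fun x hx => (hd x hx).continuousAt.continuousWithinAt)
    (fun x hx => (hd x (interior_subset hx)).hasDerivWithinAt) ?_
  intro x hx
  obtain ⟨hx0, hx1⟩ := interior_subset hx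
  have hL := lam_neg_add_pos hp hx0 hx1
  have hw : 0 < x ^ (p - 2) := by positivity
  have hxw := mul_rpow_sub_two_lt_one hp hx0 hx1
  have hC := negCoeff_pos hp hx0 hx1
  have hle := two_mul_negCoeff_le hp hx0 hx1.le
  have hB := one_sub_rpow_le (n := p - 1) (by linarith) hx0.le
  suffices (-((p - 1) * (1 - x)) / (x ^ 3 * x ^ (p - 2))) * (p - 2 + lam p (-x))
      + 2 * negCoeff p x *
        (1 / (1 - x) ^ 2 - (p - 1) ^ 2 * x ^ (p - 2) / (1 - x ^ (p - 1)) ^ 2) ≤ 0 by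
    have := mul_nonpos_of_nonneg_of_nonpos hL.le this
    simp only [Pi.pow_apply]
    push_cast
    linarith
  have hder : 0 ≤ p - 2 + lam p (-x) - x * (1 - x)
      * (1 / (1 - x) ^ 2 - (p - 1) ^ 2 * x ^ (p - 2) / (1 - x ^ (p - 1)) ^ 2) := by
    rw [lam_neg_of_pos hx0 hx1]
    rw [rpow_sub_one_eq_mul_rpow_sub_two hx0] at *
    have e1 : 1 - x ≠ 0 := by linarith
    have e2 : 1 - x * x ^ (p - 2) ≠ 0 := by linarith
    have e : p - 2 + (1 / (1 - x) - (p - 1) / (1 - x * x ^ (p - 2))) - x * (1 - x)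
        * (1 / (1 - x) ^ 2 - (p - 1) ^ 2 * x ^ (p - 2) / (1 - x * x ^ (p - 2)) ^ 2)
        = (p - 1) * x * x ^ (p - 2) * ((p - 1) * (1 - x) - (1 - x * x ^ (p - 2)))
          / (1 - x * x ^ (p - 2)) ^ 2 := by
      field_simp
      ring
    rw [e]
    exact div_nonneg (mul_nonneg (mul_nonneg (mul_nonneg (by linarith) hx0.le) hw.le)
      (by linarith)) (sq_nonneg _)
  have hder0 := deriv_lam_comp_neg_nonneg hp hx0 hx1
  generalize 1 / (1 - x) ^ 2 - (p - 1) ^ 2 * x ^ (p - 2) / (1 - x ^ (p - 1)) ^ 2 = d at *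
  generalize p - 2 + lam p (-x) = L at *
  generalize x ^ (p - 2) = w at *
  generalize negCoeff p x = C at *
  have e : -((p - 1) * (1 - x)) / (x ^ 3 * w) * L + 2 * C * d
      = (2 * C * (x ^ 2 * w) * x * d - (p - 1) * (1 - x) * L) / (x ^ 3 * w) := by
    field_simp
    ring
  rw [e]
  refine div_nonpos_of_nonpos_of_nonneg ?_ (by positivity)
  have h1 := mul_le_mul_of_nonneg_right hle (mul_nonneg hx0.le hder0)
  have h2 : 0 ≤ (p - 1) * (1 - x) * (L - x * (1 - x) * d) :=
    mul_nonneg (mul_nonneg (by linarith) (by linarith)) hder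
  linarith

end CoefficientProducts

section LevelCurves

variable {p : ℝ}

theorem weight_pos {τ P : ℝ} (h0 : 0 < τ) (h1 : τ < 1) (hP : 0 ≤ P) : 0 < τ + (1 - τ) * P := by
  have := mul_nonneg (sub_nonneg.2 h1.le) hP
  linarith

theorem normalizedMean_strictMonoOn_value (hp : 2 < p) {τ : ℝ} (h0 : 0 < τ) (h1 : τ < 1) :
    StrictMonoOn (fun x => normalizedMean (1 / p) x (x ^ p) τ) (Ioi 0) := by
  have hd := fun (x : ℝ) (hx : 0 < x) => hasDerivAt_normalizedMean (e := 1 / p)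
    (hasDerivAt_id x) (hasDerivAt_rpow_self (p := p) hx) (hasDerivAt_const x τ)
    (weight_pos h0 h1 (by positivity))
  refine strictMonoOn_of_hasDerivWithinAt_pos (convex_Ioi 0)
    (fun x hx => (hd x hx).continuousAt.continuousWithinAt)
    (fun x hx => (hd x (interior_subset hx)).hasDerivWithinAt) ?_
  intro x hx
  have hx0 : 0 < x := interior_subset hx
  have hw : 0 < x ^ (p - 2) := by positivity
  refine div_pos ?_ (Real.rpow_pos_of_pos (weight_pos h0 h1 (by positivity)) _)
  have e : (1 - τ) * (1 * (τ + (1 - τ) * x ^ p)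
      - 1 / p * (-τ + (1 - τ) * id x) * (p * (x * x ^ (p - 2))))
      - 0 * ((1 + id x) * (τ + (1 - τ) * x ^ p) + 1 / p * (-τ + (1 - τ) * id x) * (1 - x ^ p))
      = (1 - τ) * τ * (1 + x * x ^ (p - 2)) := by
    rw [rpow_eq_sq_mul_rpow_sub_two (p := p) hx0]
    simp only [id]
    field_simp
    ring
  rw [e]
  have : 0 < 1 - τ := by linarith
  positivity

theorem normalizedMean_strictMonoOn_value_dual (hp : 2 < p) {τ : ℝ} (h0 : 0 < τ) (h1 : τ < 1) :
    StrictMonoOn (fun x => normalizedMean ((p - 1) / p) (x ^ (p - 1)) (x ^ p) τ) (Ioi 0) := by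
  have hd := fun (x : ℝ) (hx : 0 < x) => hasDerivAt_normalizedMean (e := (p - 1) / p)
    (hasDerivAt_rpow_sub_one (p := p) hx) (hasDerivAt_rpow_self (p := p) hx)
    (hasDerivAt_const x τ) (weight_pos h0 h1 (by positivity))
  refine strictMonoOn_of_hasDerivWithinAt_pos (convex_Ioi 0)
    (fun x hx => (hd x hx).continuousAt.continuousWithinAt)
    (fun x hx => (hd x (interior_subset hx)).hasDerivWithinAt) ?_
  intro x hx
  have hx0 : 0 < x := interior_subset hx
  have hw : 0 < x ^ (p - 2) := by positivity
  refine div_pos ?_ (Real.rpow_pos_of_pos (weight_pos h0 h1 (by positivity)) _)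
  rw [rpow_eq_sq_mul_rpow_sub_two (p := p) hx0, rpow_sub_one_eq_mul_rpow_sub_two hx0]
  generalize x ^ (p - 2) = w at *
  have e : (1 - τ) * ((p - 1) * w * (τ + (1 - τ) * (x ^ 2 * w))
      - (p - 1) / p * (-τ + (1 - τ) * (x * w)) * (p * (x * w)))
      - 0 * ((1 + x * w) * (τ + (1 - τ) * (x ^ 2 * w))
        + (p - 1) / p * (-τ + (1 - τ) * (x * w)) * (1 - x ^ 2 * w))
      = (1 - τ) * τ * ((p - 1) * w * (1 + x)) := by
    field_simp
    ring
  rw [e]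
  have : 0 < 1 - τ := by linarith
  have : 0 < p - 1 := by linarith
  positivity

theorem normalizedMean_strictAntiOn_value_dual_neg (hp : 2 < p) {τ : ℝ} (h0 : 0 < τ)
    (h1 : τ < 1) :
    StrictAntiOn (fun x => normalizedMean ((p - 1) / p) (-x ^ (p - 1)) (x ^ p) τ) (Ioc 0 1) := by
  have hd := fun (x : ℝ) (hx : 0 < x) => hasDerivAt_normalizedMean (e := (p - 1) / p)
    (hasDerivAt_rpow_sub_one (p := p) hx).neg (hasDerivAt_rpow_self (p := p) hx)
    (hasDerivAt_const x τ) (weight_pos h0 h1 (by positivity))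
  refine strictAntiOn_of_hasDerivWithinAt_neg (convex_Ioc 0 1)
    (fun x hx => (hd x hx.1).continuousAt.continuousWithinAt)
    (fun x hx => (hd x (interior_subset hx).1).hasDerivWithinAt) ?_
  intro x hx
  rw [interior_Ioc] at hx
  have hx0 : 0 < x := hx.1
  have hx1 := hx.2
  have hw : 0 < x ^ (p - 2) := by positivity
  refine div_neg_of_neg_of_pos ?_ (Real.rpow_pos_of_pos (weight_pos h0 h1 (by positivity)) _)
  simp only [Pi.neg_apply]
  rw [rpow_eq_sq_mul_rpow_sub_two (p := p) hx0, rpow_sub_one_eq_mul_rpow_sub_two hx0]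
  generalize x ^ (p - 2) = w at *
  have e : (1 - τ) * (-((p - 1) * w) * (τ + (1 - τ) * (x ^ 2 * w))
      - (p - 1) / p * (-τ + (1 - τ) * -(x * w)) * (p * (x * w)))
      - 0 * ((1 + -(x * w)) * (τ + (1 - τ) * (x ^ 2 * w))
        + (p - 1) / p * (-τ + (1 - τ) * -(x * w)) * (1 - x ^ 2 * w))
      = -((1 - τ) * τ * ((p - 1) * w * (1 - x))) := by
    field_simp
    ring
  rw [e, neg_lt_zero]
  have : 0 < 1 - τ := by linarith
  have : 0 < p - 1 := by linarith
  have : 0 < 1 - x := by linarith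
  positivity

theorem normalizedMean_le_along_posCoeff (hp : 2 < p) {x₁ x₂ τ : ℝ} (hx₂ : 0 < x₂)
    (hle : x₂ ≤ x₁) (hx₁ : x₁ ≤ 1) (h0 : 0 < τ) (h1 : τ < 1) :
    normalizedMean (1 / p) x₁ (x₁ ^ p) τ
      ≤ normalizedMean (1 / p) x₂ (x₂ ^ p) (τ * posCoeff p x₁ / posCoeff p x₂) := by
  set k := τ * posCoeff p x₁ with hk
  have hpos : ∀ x ∈ Icc x₂ x₁, 0 < x := fun x hx => hx₂.trans_le hx.1
  have hC : ∀ x ∈ Icc x₂ x₁, 0 < posCoeff p x := fun x hx => posCoeff_pos hp (hpos x hx)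
  have hx₁mem : x₁ ∈ Icc x₂ x₁ := ⟨hle, le_rfl⟩
  have hτ0 : ∀ x ∈ Icc x₂ x₁, 0 < k / posCoeff p x := fun x hx =>
    div_pos (mul_pos h0 (hC _ hx₁mem)) (hC x hx)
  have hτ1 : ∀ x ∈ Icc x₂ x₁, k / posCoeff p x < 1 := fun x hx => by
    rw [div_lt_one (hC x hx)]
    have := posCoeff_antitoneOn hp (hpos x hx) (hpos _ hx₁mem) hx.2
    have := hC _ hx₁mem
    nlinarith
  have hd := fun (x : ℝ) (hx : x ∈ Icc x₂ x₁) => hasDerivAt_normalizedMean (e := 1 / p)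
    (hasDerivAt_id x) (hasDerivAt_rpow_self (p := p) (hpos x hx))
    ((hasDerivAt_const x k).div (hasDerivAt_posCoeff hp (hpos x hx)) (hC x hx).ne')
    (weight_pos (hτ0 x hx) (hτ1 x hx) (Real.rpow_nonneg (hpos x hx).le _))
  have hanti : AntitoneOn
      (fun x => normalizedMean (1 / p) x (x ^ p) (k / posCoeff p x)) (Icc x₂ x₁) := by
    refine antitoneOn_of_hasDerivWithinAt_nonpos (convex_Icc x₂ x₁)
      (fun x hx => (hd x hx).continuousAt.continuousWithinAt)
      (fun x hx => (hd x (interior_subset hx)).hasDerivWithinAt) ?_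
    intro x hx
    have hx' := interior_subset hx
    have hx0 := hpos x hx'
    have hx1 : x ≤ 1 := hx'.2.trans hx₁
    have hw : 0 < x ^ (p - 2) := by positivity
    have hw1 : x ^ (p - 2) ≤ 1 := Real.rpow_le_one hx0.le hx1 (by linarith)
    refine div_nonpos_of_nonpos_of_nonneg ?_ (Real.rpow_nonneg
      (weight_pos (hτ0 x hx') (hτ1 x hx') (Real.rpow_nonneg hx0.le _)).le _)
    have ht0 := hτ0 x hx'
    have hCx := hC x hx'
    have hE : posCoeff p x * (x ^ 2 * x ^ (p - 2))
        = 1 / p + x * x ^ (p - 2) + (p - 1) / p * (x ^ 2 * x ^ (p - 2)) := by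
      rw [← rpow_eq_sq_mul_rpow_sub_two hx0, ← rpow_sub_one_eq_mul_rpow_sub_two hx0, posCoeff,
        div_mul_cancel₀]
      positivity
    simp only [Pi.div_apply, id]
    rw [rpow_eq_sq_mul_rpow_sub_two (p := p) hx0]
    generalize x ^ (p - 2) = w at *
    have ed : (0 * posCoeff p x - k * (-(1 + x * w) / (x ^ 3 * w))) / posCoeff p x ^ 2
        = k / posCoeff p x * (1 + x * w) / (x ^ 3 * w * posCoeff p x) := by
      field_simp
      ring
    rw [ed]
    generalize k / posCoeff p x = t at *
    generalize posCoeff p x = C at *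
    set d := t * (1 + x * w) / (x ^ 3 * w * C) with hd
    have hd1 : d * (x * (C * (x ^ 2 * w))) = t * (1 + x * w) := by
      rw [hd]; field_simp
    have hd0 : 0 ≤ d := by positivity
    rw [hE] at hd1
    have e : (1 - t) * (1 * (t + (1 - t) * (x ^ 2 * w))
        - 1 / p * (-t + (1 - t) * x) * (p * (x * w)))
        - d * ((1 + x) * (t + (1 - t) * (x ^ 2 * w))
          + 1 / p * (-t + (1 - t) * x) * (1 - x ^ 2 * w))
        = (1 - t) * (t * (1 + x * w)
            - d * (x * (1 / p + x * w + (p - 1) / p * (x ^ 2 * w))))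
          - t * d * (1 + x - (1 - x ^ 2 * w) / p) := by
      field_simp
      ring
    rw [e, hd1, sub_self, mul_zero, zero_sub, neg_nonpos]
    refine mul_nonneg (mul_nonneg ht0.le hd0) ?_
    have : (1 - x ^ 2 * w) / p ≤ 1 := by
      rw [div_le_one (by linarith)]
      have : 0 < x ^ 2 * w := by positivity
      linarith
    linarith
  have := hanti ⟨le_rfl, hle⟩ hx₁mem hle
  simp only at this
  rwa [hk, mul_div_assoc, div_self (hC _ hx₁mem).ne', mul_one] at this

theorem normalizedMean_lt_along_negCoeff (hp : 2 < p) {x₁ x₂ τ : ℝ} (hx₂ : 0 < x₂)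
    (hlt : x₂ < x₁) (hx₁ : x₁ < 1) (h0 : 0 < τ) (h1 : τ < 1) :
    normalizedMean ((p - 1) / p) (-x₁ ^ (p - 1)) (x₁ ^ p) τ
      < normalizedMean ((p - 1) / p) (-x₂ ^ (p - 1)) (x₂ ^ p)
          (τ * negCoeff p x₁ / negCoeff p x₂) := by
  set k := τ * negCoeff p x₁ with hk
  have hpos : ∀ x ∈ Icc x₂ x₁, 0 < x := fun x hx => hx₂.trans_le hx.1
  have hC : ∀ x ∈ Icc x₂ x₁, 0 < negCoeff p x := fun x hx =>
    negCoeff_pos hp (hpos x hx) (hx.2.trans_lt hx₁)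
  have hx₁mem : x₁ ∈ Icc x₂ x₁ := ⟨hlt.le, le_rfl⟩
  have hτ0 : ∀ x ∈ Icc x₂ x₁, 0 < k / negCoeff p x := fun x hx =>
    div_pos (mul_pos h0 (hC _ hx₁mem)) (hC x hx)
  have hτ1 : ∀ x ∈ Icc x₂ x₁, k / negCoeff p x < 1 := fun x hx => by
    rw [div_lt_one (hC x hx)]
    have := (negCoeff_strictAntiOn hp).antitoneOn ⟨hpos x hx, (hx.2.trans_lt hx₁).le⟩
      ⟨hpos _ hx₁mem, hx₁.le⟩ hx.2
    have := hC _ hx₁mem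
    nlinarith
  have hd := fun (x : ℝ) (hx : x ∈ Icc x₂ x₁) => hasDerivAt_normalizedMean (e := (p - 1) / p)
    (hasDerivAt_rpow_sub_one (p := p) (hpos x hx)).neg
    (hasDerivAt_rpow_self (p := p) (hpos x hx))
    ((hasDerivAt_const x k).div (hasDerivAt_negCoeff hp (hpos x hx)) (hC x hx).ne')
    (weight_pos (hτ0 x hx) (hτ1 x hx) (Real.rpow_nonneg (hpos x hx).le _))
  have hanti : StrictAntiOn (fun x => normalizedMean ((p - 1) / p) (-x ^ (p - 1)) (x ^ p)
      (k / negCoeff p x)) (Icc x₂ x₁) := by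
    refine strictAntiOn_of_hasDerivWithinAt_neg (convex_Icc x₂ x₁)
      (fun x hx => (hd x hx).continuousAt.continuousWithinAt)
      (fun x hx => (hd x (interior_subset hx)).hasDerivWithinAt) ?_
    intro x hx
    have hx' := interior_subset hx
    have hx0 := hpos x hx'
    have hx1 : x < 1 := hx'.2.trans_lt hx₁
    have hw : 0 < x ^ (p - 2) := by positivity
    refine div_neg_of_neg_of_pos ?_ (Real.rpow_pos_of_pos
      (weight_pos (hτ0 x hx') (hτ1 x hx') (Real.rpow_nonneg hx0.le _)) _)
    have ht0 := hτ0 x hx'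
    have hCx := hC x hx'
    have hE : negCoeff p x * (x ^ 2 * x ^ (p - 2))
        = (p - 1) / p - x + x ^ 2 * x ^ (p - 2) / p := by
      rw [← rpow_eq_sq_mul_rpow_sub_two hx0, negCoeff, div_mul_cancel₀]
      positivity
    have hB := one_add_mul_self_lt_rpow_one_add (s := x⁻¹ - 1) (p := p)
      (by have := inv_pos.2 hx0; linarith) (by have := (one_lt_inv₀ hx0).2 hx1; linarith)
      (by linarith)
    rw [add_sub_cancel, Real.inv_rpow hx0.le] at hB
    simp only [Pi.div_apply, Pi.neg_apply]
    rw [rpow_eq_sq_mul_rpow_sub_two (p := p) hx0] at hB ⊢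
    rw [rpow_sub_one_eq_mul_rpow_sub_two hx0]
    generalize x ^ (p - 2) = w at *
    have ed : (0 * negCoeff p x - k * (-((p - 1) * (1 - x)) / (x ^ 3 * w))) / negCoeff p x ^ 2
        = k / negCoeff p x * ((p - 1) * (1 - x)) / (x ^ 3 * w * negCoeff p x) := by
      field_simp
      ring
    rw [ed]
    generalize k / negCoeff p x = t at *
    generalize negCoeff p x = C at *
    set d := t * ((p - 1) * (1 - x)) / (x ^ 3 * w * C) with hd
    have hd1 : d * (x * (C * (x ^ 2 * w))) = t * ((p - 1) * (1 - x)) := by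
      rw [hd]; field_simp
    have hd0 : 0 < d := by
      have : 0 < p - 1 := by linarith
      have : 0 < 1 - x := by linarith
      positivity
    rw [hE] at hd1
    have e : (1 - t) * (-((p - 1) * w) * (t + (1 - t) * (x ^ 2 * w))
        - (p - 1) / p * (-t + (1 - t) * -(x * w)) * (p * (x * w)))
        - d * ((1 + -(x * w)) * (t + (1 - t) * (x ^ 2 * w))
          + (p - 1) / p * (-t + (1 - t) * -(x * w)) * (1 - x ^ 2 * w))
        = (1 - t) * w * (d * (x * ((p - 1) / p - x + x ^ 2 * w / p)) - t * ((p - 1) * (1 - x)))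
          - t * d * (1 - x * w - (p - 1) / p * (1 - x ^ 2 * w)) := by
      field_simp
      ring
    rw [e, hd1, sub_self, mul_zero, zero_sub, neg_lt_zero]
    refine mul_pos (mul_pos ht0 hd0) ?_
    have e2 : 1 - x * w - (p - 1) / p * (1 - x ^ 2 * w)
        = x ^ 2 * w * ((x ^ 2 * w)⁻¹ - (1 + p * (x⁻¹ - 1))) / p := by
      field_simp
      ring
    rw [e2]
    have := sub_pos.2 hB
    have : 0 < p := by linarith
    positivity
  have := hanti ⟨le_rfl, hlt.le⟩ hx₁mem hlt
  simp only at this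
  rwa [hk, mul_div_assoc, div_self (hC _ hx₁mem).ne', mul_one] at this

end LevelCurves

section Coordinates

variable {p : ℝ}

/-- The first coordinate of `η` at weight `τ`, with `x = ρ R`. -/
noncomputable def etaFst (p x τ : ℝ) : ℝ := normalizedMean (1 / p) x (x ^ p) τ

/-- The second coordinate of `η` at `(τ, R)`. -/
noncomputable def etaSnd (p R τ : ℝ) : ℝ := normalizedMean ((p - 1) / p) (phi p R) (|R| ^ p) τ

theorem dual_exponent_mem_Ioo (hp : 2 < p) : (p - 1) / p ∈ Ioo (0 : ℝ) 1 :=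
  ⟨div_pos (by linarith) (by linarith), by rw [div_lt_one] <;> linarith⟩

theorem etaFst_strictAntiOn (hp : 2 < p) {x : ℝ} (hx : x ∈ Ioc (0 : ℝ) 1) :
    StrictAntiOn (etaFst p x) (Icc 0 1) := fun τ₁ h₁ τ₂ h₂ h =>
  normalizedMean_strictAnti (by have : 0 < p := by linarith
                                positivity)
    (by rw [div_lt_one] <;> linarith) hx.1 (Real.rpow_pos_of_pos hx.1 _)
    (Real.rpow_le_one hx.1.le hx.2 (by linarith)) h₁.1 h h₂.2

theorem etaSnd_strictAntiOn (hp : 2 < p) {x : ℝ} (hx : x ∈ Ioc (0 : ℝ) 1) :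
    StrictAntiOn (etaSnd p x) (Icc 0 1) := fun τ₁ h₁ τ₂ h₂ h => by
  have h0 := dual_exponent_mem_Ioo hp
  unfold etaSnd
  rw [phi_of_pos hx.1, abs_of_pos hx.1]
  exact normalizedMean_strictAnti h0.1 h0.2 (Real.rpow_pos_of_pos hx.1 _)
    (Real.rpow_pos_of_pos hx.1 _) (Real.rpow_le_one hx.1.le hx.2 (by linarith)) h₁.1 h h₂.2

theorem etaFst_strictMonoOn_value (hp : 2 < p) {τ : ℝ} (hτ : τ ∈ Ioo (0 : ℝ) 1) :
    StrictMonoOn (fun x => etaFst p x τ) (Ioi 0) :=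
  normalizedMean_strictMonoOn_value hp hτ.1 hτ.2

theorem etaSnd_strictMonoOn_value (hp : 2 < p) {τ : ℝ} (hτ : τ ∈ Ioo (0 : ℝ) 1) :
    StrictMonoOn (fun x => etaSnd p x τ) (Ioi 0) :=
  (normalizedMean_strictMonoOn_value_dual hp hτ.1 hτ.2).congr fun x hx => by
    rw [etaSnd, phi_of_pos hx, abs_of_pos hx]

theorem etaSnd_neg {x : ℝ} (hx : 0 < x) (τ : ℝ) :
    etaSnd p (-x) τ = normalizedMean ((p - 1) / p) (-x ^ (p - 1)) (x ^ p) τ := by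
  rw [etaSnd, phi_neg_of_pos hx, abs_neg, abs_of_pos hx]

theorem etaSnd_neg_strictAntiOn_value (hp : 2 < p) {τ : ℝ} (hτ : τ ∈ Ioo (0 : ℝ) 1) :
    StrictAntiOn (fun x => etaSnd p (-x) τ) (Ioc 0 1) :=
  (normalizedMean_strictAntiOn_value_dual_neg hp hτ.1 hτ.2).congr fun x hx => by
    rw [etaSnd_neg hx.1]

theorem etaSnd_neg_lt_zero {x τ : ℝ} (hx : 0 < x) (hτ : τ ∈ Ioo (0 : ℝ) 1) :
    etaSnd p (-x) τ < 0 := by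
  have h1 : 0 < 1 - τ := by linarith [hτ.2]
  have h0 := hτ.1
  rw [etaSnd_neg hx]
  refine div_neg_of_neg_of_pos ?_ (by positivity)
  have : 0 < (1 - τ) * x ^ (p - 1) := by positivity
  linarith

theorem weight_le_of_etaFst_eq (hp : 2 < p) {ρ₁ ρ₂ τ₁ τ₂ : ℝ} (hρ₂ : 0 < ρ₂) (hle : ρ₂ ≤ ρ₁)
    (hρ₁ : ρ₁ ≤ 1) (hτ₁ : τ₁ ∈ Ioo (0 : ℝ) 1) (hτ₂ : τ₂ ∈ Ioo (0 : ℝ) 1)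
    (h : etaFst p ρ₁ τ₁ = etaFst p ρ₂ τ₂) : τ₂ ≤ τ₁ := by
  by_contra! hlt
  have h1 := etaFst_strictAntiOn hp ⟨hρ₂.trans_le hle, hρ₁⟩ ⟨hτ₁.1.le, hτ₁.2.le⟩
    ⟨hτ₂.1.le, hτ₂.2.le⟩ hlt
  have h2 := (etaFst_strictMonoOn_value hp hτ₂).monotoneOn hρ₂ (hρ₂.trans_le hle) hle
  linarith

theorem etaSnd_lt_of_neg (hp : 2 < p) {R₀ x₁ x₂ ρ₁ ρ₂ τ₁ τ₂ : ℝ} (h0 : 0 < R₀)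
    (hmono : StrictMonoOn (lam p) (Icc R₀ 1)) (hx₂ : 0 < x₂) (hlt : x₂ < x₁) (hx₁ : x₁ < 1)
    (hρ₁ : ρ₁ ∈ Icc R₀ 1) (hρ₂ : ρ₂ ∈ Icc R₀ 1) (hlam₁ : lam p ρ₁ = lam p (-x₁))
    (hlam₂ : lam p ρ₂ = lam p (-x₂)) (hτ₁ : τ₁ ∈ Ioo (0 : ℝ) 1) (hτ₂ : τ₂ ∈ Ioo (0 : ℝ) 1)
    (h : etaFst p ρ₁ τ₁ = etaFst p ρ₂ τ₂) :
    etaSnd p (-x₁) τ₁ < etaSnd p (-x₂) τ₂ := by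
  have hx₁0 := hx₂.trans hlt
  have hρ₂0 : 0 < ρ₂ := h0.trans_le hρ₂.1
  have hle : ρ₂ ≤ ρ₁ := (hmono.le_iff_le hρ₂ hρ₁).1 <| by
    rw [hlam₁, hlam₂]
    exact monotoneOn_lam_comp_neg hp ⟨hx₂, hlt.trans hx₁⟩ ⟨hx₁0, hx₁⟩ hlt.le
  have hρ₁0 := hρ₂0.trans_le hle
  have hτ := weight_le_of_etaFst_eq hp hρ₂0 hle hρ₁.2 hτ₁ hτ₂ h
  have hL₁ := lam_neg_add_pos hp hx₁0 hx₁
  have hL₂ := lam_neg_add_pos hp hx₂ (hlt.trans hx₁)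
  have hC₁ := posCoeff_pos hp hρ₁0
  have hC₂ := posCoeff_pos hp hρ₂0
  have hK₁ := negCoeff_pos hp hx₁0 hx₁
  have hK₂ := negCoeff_pos hp hx₂ (hlt.trans hx₁)
  have hCC : posCoeff p ρ₁ ≤ posCoeff p ρ₂ := posCoeff_antitoneOn hp hρ₂0 hρ₁0 hle
  have hfst : τ₁ * posCoeff p ρ₁ / posCoeff p ρ₂ ≤ τ₂ := by
    have h1 := normalizedMean_le_along_posCoeff hp hρ₂0 hle hρ₁.2 hτ₁.1 hτ₁.2
    have hs0 : 0 ≤ τ₁ * posCoeff p ρ₁ / posCoeff p ρ₂ := by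
      have := hτ₁.1
      positivity
    have hs1 : τ₁ * posCoeff p ρ₁ / posCoeff p ρ₂ ≤ 1 := by
      rw [div_le_one hC₂]
      nlinarith [hτ₁.2, hτ₁.1]
    refine ((etaFst_strictAntiOn hp ⟨hρ₂0, hρ₂.2⟩).le_iff_ge ⟨hτ₂.1.le, hτ₂.2.le⟩ ⟨hs0, hs1⟩).1 ?_
    rw [← h]
    exact h1
  have hcross : posCoeff p ρ₂ * negCoeff p x₁ ≤ posCoeff p ρ₁ * negCoeff p x₂ := by
    have h1 := monotoneOn_posCoeff_mul_sq hp hρ₂0 hρ₁.2 (fun x hx => by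
      have := hmono.monotoneOn hρ₂ ⟨hρ₂.1.trans hx.1, hx.2.trans hρ₁.2⟩ hx.1
      rw [hlam₂] at this
      linarith) ⟨le_rfl, hle⟩ ⟨hle, le_rfl⟩ hle
    have h2 := antitoneOn_negCoeff_mul_sq hp ⟨hx₂, hlt.trans hx₁⟩ ⟨hx₁0, hx₁⟩ hlt.le
    simp only [hlam₁, hlam₂] at h1 h2
    have h3 := mul_le_mul h1 h2 (by positivity) (by positivity)
    have h4 : 0 < (p - 2 + lam p (-x₁)) ^ 2 * (p - 2 + lam p (-x₂)) ^ 2 := by positivity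
    refine le_of_mul_le_mul_right ?_ h4
    linarith
  have hsnd : τ₁ * negCoeff p x₁ / negCoeff p x₂ ≤ τ₂ := by
    refine le_trans ?_ hfst
    rw [div_le_div_iff₀ hK₂ hC₂]
    nlinarith [hτ₁.1]
  have hm := etaSnd_neg_lt_zero (p := p) hx₁0 hτ₁
  have hend : etaSnd p (-x₁) τ₁ < etaSnd p (-x₂) τ₁ :=
    etaSnd_neg_strictAntiOn_value hp hτ₁ ⟨hx₂, (hlt.trans hx₁).le⟩ ⟨hx₁0, hx₁.le⟩ hlt
  have hstart := normalizedMean_lt_along_negCoeff hp hx₂ hlt hx₁ hτ₁.1 hτ₁.2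
  rw [etaSnd_neg hx₁0] at hm hend ⊢
  rw [etaSnd_neg hx₂] at hend ⊢
  have he := dual_exponent_mem_Ioo hp
  refine lt_normalizedMean_of_between he.1 he.2 (by positivity) hm ?_ hsnd hτ hτ₁.2.le hstart hend
  have := hτ₁.1
  positivity

theorem etaSnd_lt_of_pos (hp : 2 < p) {R₀ x₁ x₂ ρ₁ ρ₂ τ₁ τ₂ : ℝ} (h0 : 0 < R₀)
    (h1 : R₀ < 1) (hmono : StrictMonoOn (lam p) (Icc R₀ 1)) (hanti : AntitoneOn (lam p) (Ioc 0 R₀))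
    (hx₁ : 0 < x₁) (hlt : x₁ < x₂) (hx₂ : x₂ ≤ R₀)
    (hρ₁ : ρ₁ ∈ Icc R₀ 1) (hρ₂ : ρ₂ ∈ Icc R₀ 1) (hlam₁ : lam p ρ₁ = lam p x₁)
    (hlam₂ : lam p ρ₂ = lam p x₂) (hτ₁ : τ₁ ∈ Ioo (0 : ℝ) 1) (hτ₂ : τ₂ ∈ Ioo (0 : ℝ) 1)
    (h : etaFst p ρ₁ τ₁ = etaFst p ρ₂ τ₂) :
    etaSnd p x₁ τ₁ < etaSnd p x₂ τ₂ := by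
  have hx₂0 := hx₁.trans hlt
  have hle : ρ₂ ≤ ρ₁ := (hmono.le_iff_le hρ₂ hρ₁).1 <| by
    rw [hlam₁, hlam₂]
    exact hanti ⟨hx₁, hlt.le.trans hx₂⟩ ⟨hx₂0, hx₂⟩ hlt.le
  have hτ := weight_le_of_etaFst_eq hp (h0.trans_le hρ₂.1) hle hρ₁.2 hτ₁ hτ₂ h
  calc etaSnd p x₁ τ₁ < etaSnd p x₂ τ₁ := etaSnd_strictMonoOn_value hp hτ₁ hx₁ hx₂0 hlt
    _ ≤ etaSnd p x₂ τ₂ := (etaSnd_strictAntiOn hp ⟨hx₂0, hx₂.trans h1.le⟩).antitoneOn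
        ⟨hτ₂.1.le, hτ₂.2.le⟩ ⟨hτ₁.1.le, hτ₁.2.le⟩ hτ

theorem eventually_lt_of_hasDerivAt_pos {f : ℝ → ℝ} {f' x : ℝ} (hf : HasDerivAt f f' x)
    (h : 0 < f') : ∀ᶠ z in 𝓝[>] x, f x < f z := by
  have h1 := (hasDerivAt_iff_tendsto_slope.1 hf).mono_left
    (nhdsWithin_mono x fun z (hz : x < z) => ne_of_gt hz)
  filter_upwards [h1.eventually (lt_mem_nhds h), self_mem_nhdsWithin] with z hz hxz
  have hxz' : 0 < z - x := sub_pos.2 hxz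
  rw [slope_def_field, div_pos_iff_of_pos_right hxz'] at hz
  exact sub_pos.1 hz

theorem eventually_etaSnd_lt_of_etaFst_eq (hp : 2 < p) {x τ c : ℝ} {T : ℝ → ℝ} (hx : 0 < x)
    (hx1 : x < 1) (hcrit : (1 + x ^ (p - 1)) ^ 2 / ((1 + x) ^ 2 * x ^ (p - 2)) < (p - 1) ^ 2)
    (hτ : τ ∈ Ioo (0 : ℝ) 1) (hc : etaFst p x τ = c)
    (hT : ∀ᶠ z in 𝓝[>] x, T z ∈ Ioo (0 : ℝ) 1 ∧ etaFst p z (T z) = c) :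
    ∀ᶠ z in 𝓝[>] x, etaSnd p x τ < etaSnd p z (T z) := by
  obtain ⟨h0, h1⟩ := hτ
  have h1' : 0 < 1 - τ := by linarith
  have hw : 0 < x ^ (p - 2) := by positivity
  have hw1 : x ^ (p - 2) < 1 := Real.rpow_lt_one hx.le hx1 (by linarith)
  have hP : x ^ p = x ^ 2 * x ^ (p - 2) := rpow_eq_sq_mul_rpow_sub_two hx
  have hS : x ^ (p - 1) = x * x ^ (p - 2) := rpow_sub_one_eq_mul_rpow_sub_two hx
  have hP1 : x ^ p < 1 := Real.rpow_lt_one hx.le hx1 (by linarith)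
  have hP0 : 0 < x ^ p := by positivity
  have hp0 : 0 < p := by linarith
  set D := τ + (1 - τ) * x ^ p with hD
  have hD0 : 0 < D := weight_pos h0 h1 hP0.le
  set P₁ := τ * (1 - τ) * (1 + x ^ (p - 1)) with hP₁
  set P₂ := τ * (1 - τ) * ((p - 1) * x ^ (p - 2) * (1 + x)) with hP₂
  set Q₁ := (1 + x) * D + 1 / p * (-τ + (1 - τ) * x) * (1 - x ^ p) with hQ₁
  set Q₂ := (1 + x ^ (p - 1)) * D + (p - 1) / p * (-τ + (1 - τ) * x ^ (p - 1)) * (1 - x ^ p)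
    with hQ₂
  have hQpos : ∀ s e : ℝ, 0 < s → 0 ≤ e → e ≤ 1 →
      0 < (1 + s) * D + e * (-τ + (1 - τ) * s) * (1 - x ^ p) := by
    intro s e hs he he1
    have : (1 + s) * D + e * (-τ + (1 - τ) * s) * (1 - x ^ p)
        = s * D + (1 - τ) * x ^ p + τ * (1 - e * (1 - x ^ p))
          + e * (1 - τ) * s * (1 - x ^ p) := by rw [hD]; ring
    rw [this]
    have h2 : 0 < 1 - x ^ p := by linarith
    have h3 : 0 ≤ 1 - e * (1 - x ^ p) := by nlinarith
    positivity
  have he := dual_exponent_mem_Ioo hp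
  have hQ₁0 : 0 < Q₁ := hQpos x (1 / p) hx (by positivity) (by rw [div_le_one] <;> linarith)
  have hQ₂0 : 0 < Q₂ := hQpos (x ^ (p - 1)) _ (by positivity) he.1.le he.2.le
  have hslope : P₁ / Q₁ < P₂ / Q₂ := by
    rw [div_lt_div_iff₀ hQ₁0 hQ₂0, ← sub_pos]
    rw [div_lt_iff₀ (by positivity), hS] at hcrit
    have e : P₂ * Q₁ - P₁ * Q₂ = τ * (1 - τ) / p * D
        * ((p - 1) ^ 2 * ((1 + x) ^ 2 * x ^ (p - 2)) - (1 + x * x ^ (p - 2)) ^ 2) := by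
      rw [hP₁, hP₂, hQ₁, hQ₂, hD, hS, hP]
      generalize x ^ (p - 2) = w
      field_simp
      ring
    rw [e]
    have := sub_pos.2 hcrit
    positivity
  obtain ⟨s, hs1, hs2⟩ := exists_between hslope
  rw [div_lt_iff₀ hQ₁0] at hs1
  rw [lt_div_iff₀ hQ₂0] at hs2
  have hline : HasDerivAt (fun z => τ + s * (z - x)) s x := by
    simpa using (((hasDerivAt_id x).sub_const x).const_mul s).const_add τ
  have hlx : τ + s * (x - x) = τ := by simp
  have hDx : 0 < τ + s * (x - x) + (1 - (τ + s * (x - x))) * x ^ p := by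
    rw [hlx]; exact hD0
  have hF := hasDerivAt_normalizedMean (e := 1 / p) (hasDerivAt_id x)
    (hasDerivAt_rpow_self (p := p) hx) hline hDx
  have hG := hasDerivAt_normalizedMean (e := (p - 1) / p) (hasDerivAt_rpow_sub_one (p := p) hx)
    (hasDerivAt_rpow_self (p := p) hx) hline hDx
  rw [hlx] at hF hG
  have eF : (1 - τ) * (1 * D - 1 / p * (-τ + (1 - τ) * id x) * (p * (x * x ^ (p - 2)))) = P₁ := by
    rw [hD, hP, hP₁, hS, id]
    field_simp
    ring
  have eG : (1 - τ) * ((p - 1) * x ^ (p - 2) * D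
      - (p - 1) / p * (-τ + (1 - τ) * x ^ (p - 1)) * (p * (x * x ^ (p - 2)))) = P₂ := by
    rw [hD, hP, hP₂, hS]
    field_simp
    ring
  rw [← hD, eF] at hF
  rw [← hD, eG] at hG
  have hFlt := eventually_lt_of_hasDerivAt_pos hF.neg (by
    rw [neg_pos]
    exact div_neg_of_neg_of_pos (sub_neg.2 hs1) (by positivity))
  have hGlt := eventually_lt_of_hasDerivAt_pos hG (div_pos (sub_pos.2 hs2) (by positivity))
  have hmem : ∀ᶠ z in 𝓝[>] x, τ + s * (z - x) ∈ Ioo (0 : ℝ) 1 :=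
    (hline.continuousAt.tendsto.mono_left nhdsWithin_le_nhds).eventually
      (Ioo_mem_nhds (by rw [hlx]; exact h0) (by rw [hlx]; exact h1))
  filter_upwards [hFlt, hGlt, hmem, hT, Ioo_mem_nhdsGT hx1] with z hFz hGz hl hTz hz
  have hz0 : z ∈ Ioc (0 : ℝ) 1 := ⟨hx.trans hz.1, hz.2.le⟩
  simp only [Pi.neg_apply, neg_lt_neg_iff, sub_self, mul_zero, add_zero, id] at hFz hGz
  have hlt : T z < τ + s * (z - x) := by
    refine ((etaFst_strictAntiOn hp hz0).lt_iff_gt ⟨hl.1.le, hl.2.le⟩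
      ⟨hTz.1.1.le, hTz.1.2.le⟩).1 ?_
    rw [hTz.2, ← hc]
    exact hFz
  have h2 := etaSnd_strictAntiOn hp hz0 ⟨hTz.1.1.le, hTz.1.2.le⟩ ⟨hl.1.le, hl.2.le⟩ hlt
  refine lt_trans ?_ h2
  unfold etaSnd
  rwa [phi_of_pos hx, phi_of_pos hz0.1, abs_of_pos hx, abs_of_pos hz0.1]

end Coordinates

section LevelSets

variable {p R₀ c : ℝ} {ρ t : ℝ → ℝ}

theorem StrictMonoOn.continuousOn_of_comp_eq {f g r : ℝ → ℝ} {a b : ℝ} {s : Set ℝ}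
    (hf : StrictMonoOn f (Icc a b)) (hg : ContinuousOn g s)
    (hr : ∀ x ∈ s, r x ∈ Icc a b ∧ f (r x) = g x) : ContinuousOn r s := by
  intro x hx
  refine tendsto_order.2 ⟨fun l hl => ?_, fun u hu => ?_⟩
  · rcases lt_or_ge l a with hla | hla
    · filter_upwards [self_mem_nhdsWithin] with y hy using hla.trans_le (hr y hy).1.1
    · have hl' : l ∈ Icc a b := ⟨hla, hl.le.trans (hr x hx).1.2⟩
      have h := hf hl' (hr x hx).1 hl
      rw [(hr x hx).2] at h
      filter_upwards [(hg x hx).eventually (lt_mem_nhds h), self_mem_nhdsWithin] with y hy hys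
      rw [← (hr y hys).2] at hy
      exact (hf.lt_iff_lt hl' (hr y hys).1).1 hy
  · rcases lt_or_ge b u with hbu | hbu
    · filter_upwards [self_mem_nhdsWithin] with y hy using (hr y hy).1.2.trans_lt hbu
    · have hu' : u ∈ Icc a b := ⟨(hr x hx).1.1.trans hu.le, hbu⟩
      have h := hf (hr x hx).1 hu' hu
      rw [(hr x hx).2] at h
      filter_upwards [(hg x hx).eventually (gt_mem_nhds h), self_mem_nhdsWithin] with y hy hys
      rw [← (hr y hys).2] at hy
      exact (hf.lt_iff_lt (hr y hys).1 hu').1 hy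

theorem ContinuousOn.normalizedMean {e : ℝ} {v P τ : ℝ → ℝ} {s : Set ℝ} (hv : ContinuousOn v s)
    (hP : ContinuousOn P s) (hτ : ContinuousOn τ s) (h : ∀ x ∈ s, 0 < τ x + (1 - τ x) * P x) :
    ContinuousOn (fun x => normalizedMean e (v x) (P x) (τ x)) s := by
  have hb : ContinuousOn (fun x => 1 - τ x) s := continuousOn_const.sub hτ
  exact (hτ.neg.add (hb.mul hv)).div
    ((hτ.add (hb.mul hP)).rpow_const fun x hx => Or.inl (h x hx).ne')
    fun x hx => (Real.rpow_pos_of_pos (h x hx) _).ne'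

theorem weight_pos_of_mem_Icc {τ P : ℝ} (hτ : τ ∈ Icc (0 : ℝ) 1) (hP : 0 < P) :
    0 < τ + (1 - τ) * P := by
  rcases hτ.1.eq_or_lt with rfl | h
  · simpa
  · have := mul_nonneg (sub_nonneg.2 hτ.2) hP.le
    linarith

theorem etaFst_zero (hp : 2 < p) {x : ℝ} (hx : 0 < x) : etaFst p x 0 = 1 := by
  have h : (x ^ p) ^ (1 / p) = x := by
    rw [← Real.rpow_mul hx.le, mul_one_div_cancel (by linarith), Real.rpow_one]
  simp only [etaFst, normalizedMean, neg_zero, sub_zero, one_mul, zero_add]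
  rw [h, div_self hx.ne']

theorem etaFst_one {x : ℝ} : etaFst p x 1 = -1 := by
  simp [etaFst, normalizedMean]

theorem etaSnd_one_eq_etaFst_one (τ : ℝ) : etaSnd p 1 τ = etaFst p 1 τ := by
  simp [etaSnd, etaFst, normalizedMean, phi]

theorem etaFst_mem_Ioo (hp : 2 < p) {x τ : ℝ} (hx : x ∈ Ioc (0 : ℝ) 1) (hτ : τ ∈ Ioo (0 : ℝ) 1) :
    etaFst p x τ ∈ Ioo (-1 : ℝ) 1 := by
  have h0 := etaFst_strictAntiOn hp hx ⟨le_rfl, zero_le_one⟩ ⟨hτ.1.le, hτ.2.le⟩ hτ.1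
  have h1 := etaFst_strictAntiOn hp hx ⟨hτ.1.le, hτ.2.le⟩ ⟨zero_le_one, le_rfl⟩ hτ.2
  rw [etaFst_zero hp hx.1] at h0
  rw [etaFst_one] at h1
  exact ⟨h1, h0⟩

theorem exists_etaFst_eq (hp : 2 < p) {x : ℝ} (hx : x ∈ Ioc (0 : ℝ) 1) (hc : c ∈ Ioo (-1 : ℝ) 1) :
    ∃ τ ∈ Ioo (0 : ℝ) 1, etaFst p x τ = c := by
  have hcont : ContinuousOn (etaFst p x) (Icc 0 1) :=
    ContinuousOn.normalizedMean continuousOn_const continuousOn_const continuousOn_id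
      fun τ hτ => weight_pos_of_mem_Icc hτ (Real.rpow_pos_of_pos hx.1 p)
  refine intermediate_value_Ioo' zero_le_one hcont ?_
  rwa [etaFst_zero hp hx.1, etaFst_one]

theorem neg_one_lt_etaSnd_neg (hp : 2 < p) {x τ : ℝ} (hx : x ∈ Ioo (0 : ℝ) 1)
    (hτ : τ ∈ Ioo (0 : ℝ) 1) : -1 < etaSnd p (-x) τ := by
  have h := etaSnd_neg_strictAntiOn_value hp hτ ⟨hx.1, hx.2.le⟩ ⟨zero_lt_one, le_rfl⟩ hx.2
  have h1 : etaSnd p (-1) τ = -1 := by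
    rw [etaSnd_neg zero_lt_one, normalizedMean]
    simp only [Real.one_rpow]
    ring_nf
    simp
  simpa only [h1] using h

theorem etaSnd_neg_le (hp : 2 < p) {x τ : ℝ} (hx : x ∈ Ioo (0 : ℝ) 1)
    (hτ : τ ∈ Ioo (0 : ℝ) 1) : etaSnd p (-x) τ ≤ -x ^ (p - 1) := by
  have hx0 := hx.1
  have hS0 : 0 < x ^ (p - 1) := by positivity
  have hS1 : x ^ (p - 1) < 1 := Real.rpow_lt_one hx0.le hx.2 (by linarith)
  have hP1 : x ^ p < 1 := Real.rpow_lt_one hx0.le hx.2 (by linarith)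
  have hD := weight_pos hτ.1 hτ.2 (Real.rpow_pos_of_pos hx0 p).le
  have h1 : 0 < 1 - τ := by linarith [hτ.2]
  have hD1 : (τ + (1 - τ) * x ^ p) ^ ((p - 1) / p) ≤ 1 :=
    Real.rpow_le_one hD.le (by nlinarith) (dual_exponent_mem_Ioo hp).1.le
  rw [etaSnd_neg hx0, normalizedMean, div_le_iff₀ (by positivity)]
  nlinarith [mul_le_mul_of_nonneg_left hD1 hS0.le, mul_pos hτ.1 (sub_pos.2 hS1)]

theorem continuousOn_of_etaFst_eq (hp : 2 < p) {s : Set ℝ} (hρc : ContinuousOn ρ s)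
    (hρ : ∀ R ∈ s, ρ R ∈ Ioc (0 : ℝ) 1)
    (ht : ∀ R ∈ s, t R ∈ Ioo (0 : ℝ) 1 ∧ etaFst p (ρ R) (t R) = c) : ContinuousOn t s := by
  have hcont : ∀ τ ∈ Icc (0 : ℝ) 1, ContinuousOn (fun R => etaFst p (ρ R) τ) s := fun τ hτ =>
    hρc.normalizedMean (hρc.rpow_const fun R hR => Or.inl (hρ R hR).1.ne') continuousOn_const
      fun R hR => weight_pos_of_mem_Icc hτ (Real.rpow_pos_of_pos (hρ R hR).1 p)
  intro x hx
  obtain ⟨ht0, ht1⟩ := (ht x hx).1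
  have hmem : ∀ R ∈ s, t R ∈ Icc (0 : ℝ) 1 := fun R hR => Ioo_subset_Icc_self (ht R hR).1
  refine tendsto_order.2 ⟨fun l hl => ?_, fun u hu => ?_⟩
  · have hl' : max l 0 ∈ Icc (0 : ℝ) 1 := ⟨le_max_right _ _, (max_lt hl ht0).le.trans ht1.le⟩
    have h := etaFst_strictAntiOn hp (hρ x hx) hl' (hmem x hx) (max_lt hl ht0)
    rw [(ht x hx).2] at h
    filter_upwards [(hcont _ hl' x hx).eventually (lt_mem_nhds h), self_mem_nhdsWithin]
      with y hy hys
    rw [← (ht y hys).2] at hy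
    exact (le_max_left _ _).trans_lt
      (((etaFst_strictAntiOn hp (hρ y hys)).lt_iff_gt (hmem y hys) hl').1 hy)
  · have hu' : min u 1 ∈ Icc (0 : ℝ) 1 := ⟨ht0.le.trans (lt_min hu ht1).le, min_le_right _ _⟩
    have h := etaFst_strictAntiOn hp (hρ x hx) (hmem x hx) hu' (lt_min hu ht1)
    rw [(ht x hx).2] at h
    filter_upwards [(hcont _ hu' x hx).eventually (gt_mem_nhds h), self_mem_nhdsWithin]
      with y hy hys
    rw [← (ht y hys).2] at hy
    exact (((etaFst_strictAntiOn hp (hρ y hys)).lt_iff_gt hu' (hmem y hys)).1 hy).trans_le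
      (min_le_left _ _)

theorem continuousOn_etaSnd_level (hp : 2 < p) (h0 : 0 < R₀)
    (hmono : StrictMonoOn (lam p) (Icc R₀ 1))
    (hρ : ∀ R ∈ Ioc (-1 : ℝ) 1, ρ R ∈ Icc R₀ 1 ∧ lam p (ρ R) = lam p R)
    (ht : ∀ R ∈ Ioc (-1 : ℝ) 1, t R ∈ Ioo (0 : ℝ) 1 ∧ etaFst p (ρ R) (t R) = c) :
    ContinuousOn (fun R => etaSnd p R (t R)) (Ioc (-1) 1) := by
  have hρc : ContinuousOn ρ (Ioc (-1) 1) :=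
    hmono.continuousOn_of_comp_eq ((continuousOn_lam hp).mono fun R hR => hR.1) hρ
  have htc : ContinuousOn t (Ioc (-1) 1) := continuousOn_of_etaFst_eq hp hρc
    (fun R hR => ⟨h0.trans_le (hρ R hR).1.1, (hρ R hR).1.2⟩) ht
  exact (continuous_phi hp).continuousOn.normalizedMean
    (continuous_abs.rpow_const fun _ => Or.inr (by linarith)).continuousOn htc
    fun R hR => weight_pos (ht R hR).1.1 (ht R hR).1.2 (by positivity)

theorem strictMonoOn_etaSnd_level (hp : 2 < p) (h0 : 0 < R₀) (h1 : R₀ < 1)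
    (hcrit : (1 + R₀ ^ (p - 1)) ^ 2 / ((1 + R₀) ^ 2 * R₀ ^ (p - 2)) = (p - 1) ^ 2)
    (hρid : ∀ R ∈ Icc R₀ (1 : ℝ), ρ R = R)
    (hρ : ∀ R ∈ Ioc (-1 : ℝ) 1, ρ R ∈ Icc R₀ 1 ∧ lam p (ρ R) = lam p R)
    (ht : ∀ R ∈ Ioc (-1 : ℝ) 1, t R ∈ Ioo (0 : ℝ) 1 ∧ etaFst p (ρ R) (t R) = c) :
    StrictMonoOn (fun R => etaSnd p R (t R)) (Ioc (-1) 1) := by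
  have hmono := strictMonoOn_lam hp h0 h1 hcrit
  have hanti := antitoneOn_lam hp h0 h1 hcrit
  have hcont := continuousOn_etaSnd_level hp h0 hmono hρ ht
  have hneg : ∀ a : ℝ, -1 < a → StrictMonoOn (fun R => etaSnd p R (t R)) (Icc a 0) := by
    intro a ha
    refine StrictMonoOn.Icc_of_Ioo
      (hcont.mono fun x hx => ⟨ha.trans_le hx.1, hx.2.trans zero_le_one⟩) fun x hx y hy hxy => ?_
    have hx' : x ∈ Ioc (-1 : ℝ) 1 := ⟨ha.trans hx.1, hx.2.le.trans zero_le_one⟩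
    have hy' : y ∈ Ioc (-1 : ℝ) 1 := ⟨ha.trans hy.1, hy.2.le.trans zero_le_one⟩
    have h := etaSnd_lt_of_neg hp (x₁ := -x) (x₂ := -y) h0 hmono (neg_pos.2 hy.2)
      (neg_lt_neg hxy) (by linarith [hx'.1]) (hρ x hx').1 (hρ y hy').1
      (by rw [neg_neg]; exact (hρ x hx').2) (by rw [neg_neg]; exact (hρ y hy').2)
      (ht x hx').1 (ht y hy').1 ((ht x hx').2.trans (ht y hy').2.symm)
    simpa only [neg_neg] using h
  have hmid : StrictMonoOn (fun R => etaSnd p R (t R)) (Icc 0 R₀) := by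
    refine StrictMonoOn.Icc_of_Ioo
      (hcont.mono fun x hx => ⟨by linarith [hx.1], hx.2.trans h1.le⟩) fun x hx y hy hxy => ?_
    have hx' : x ∈ Ioc (-1 : ℝ) 1 := ⟨by linarith [hx.1], (hx.2.trans h1).le⟩
    have hy' : y ∈ Ioc (-1 : ℝ) 1 := ⟨by linarith [hy.1], (hy.2.trans h1).le⟩
    exact etaSnd_lt_of_pos hp h0 h1 hmono hanti hx.1 hxy hy.2.le (hρ x hx').1 (hρ y hy').1
      (hρ x hx').2 (hρ y hy').2 (ht x hx').1 (ht y hy').1 ((ht x hx').2.trans (ht y hy').2.symm)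
  have hright : StrictMonoOn (fun R => etaSnd p R (t R)) (Icc R₀ 1) := by
    refine strictMonoOn_Icc_of_eventually_gt
      (hcont.mono fun x hx => ⟨by linarith [hx.1], hx.2⟩) fun x hx => ?_
    have ht' : ∀ z ∈ Icc R₀ (1 : ℝ), t z ∈ Ioo (0 : ℝ) 1 ∧ etaFst p z (t z) = c := fun z hz => by
      have := ht z ⟨by linarith [hz.1], hz.2⟩
      rwa [hρid z hz] at this
    have hxR : x ∈ Icc R₀ (1 : ℝ) := Ioo_subset_Icc_self hx
    refine eventually_etaSnd_lt_of_etaFst_eq hp (h0.trans hx.1) hx.2 ?_ (ht' x hxR).1 (ht' x hxR).2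
      ?_
    · rw [← hcrit]
      exact strictAntiOn_critical_ratio hp ⟨h0, h1.le⟩ ⟨h0.trans hx.1, hx.2.le⟩ hx.1
    · filter_upwards [Ioo_mem_nhdsGT hx.2] with z hz using ht' z ⟨hx.1.le.trans hz.1.le, hz.2.le⟩
  intro x hx y hy hxy
  have ha : -1 < min x 0 := lt_min hx.1 (by norm_num)
  have h := ((hneg _ ha).union hmid (isGreatest_Icc (min_le_right x 0)) (isLeast_Icc h0.le))
  rw [Icc_union_Icc_eq_Icc (min_le_right x 0) h0.le] at h
  have h' := h.union hright (isGreatest_Icc ((min_le_right x 0).trans h0.le)) (isLeast_Icc h1.le)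
  rw [Icc_union_Icc_eq_Icc ((min_le_right x 0).trans h0.le) h1.le] at h'
  exact h' ⟨min_le_left x 0, hx.2⟩ ⟨(min_le_left x 0).trans hxy.le, hy.2⟩ hxy

theorem bijOn_etaFst_etaSnd (hp : 2 < p) (h0 : 0 < R₀) (h1 : R₀ < 1)
    (hcrit : (1 + R₀ ^ (p - 1)) ^ 2 / ((1 + R₀) ^ 2 * R₀ ^ (p - 2)) = (p - 1) ^ 2)
    (hρid : ∀ R ∈ Icc R₀ (1 : ℝ), ρ R = R)
    (hρ : ∀ R ∈ Ioc (-1 : ℝ) 1, ρ R ∈ Icc R₀ 1 ∧ lam p (ρ R) = lam p R) :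
    BijOn (fun z : ℝ × ℝ => (etaFst p (ρ z.2) z.1, etaSnd p z.2 z.1))
      (Ioo (0 : ℝ) 1 ×ˢ Ioo (-1 : ℝ) 1) {y : ℝ × ℝ | -1 < y.2 ∧ y.2 < y.1 ∧ y.1 < 1} := by
  have hρ' : ∀ R ∈ Ioc (-1 : ℝ) 1, ρ R ∈ Ioc (0 : ℝ) 1 := fun R hR =>
    ⟨h0.trans_le (hρ R hR).1.1, (hρ R hR).1.2⟩
  have hone : (1 : ℝ) ∈ Ioc (-1 : ℝ) 1 := ⟨by norm_num, le_rfl⟩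
  have level : ∀ c ∈ Ioo (-1 : ℝ) 1, ∃ t : ℝ → ℝ, ∀ R ∈ Ioc (-1 : ℝ) 1,
      t R ∈ Ioo (0 : ℝ) 1 ∧ etaFst p (ρ R) (t R) = c := by
    intro c hc
    choose! t ht using fun R hR => exists_etaFst_eq hp (hρ' R hR) hc
    exact ⟨t, ht⟩
  have uniq : ∀ R ∈ Ioc (-1 : ℝ) 1, ∀ τ ∈ Ioo (0 : ℝ) 1, ∀ τ' ∈ Ioo (0 : ℝ) 1,
      etaFst p (ρ R) τ = etaFst p (ρ R) τ' → τ = τ' := fun R hR τ hτ τ' hτ' h =>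
    (etaFst_strictAntiOn hp (hρ' R hR)).injOn (Ioo_subset_Icc_self hτ) (Ioo_subset_Icc_self hτ') h
  have endpoint : ∀ (c : ℝ) (t : ℝ → ℝ), (∀ R ∈ Ioc (-1 : ℝ) 1,
      t R ∈ Ioo (0 : ℝ) 1 ∧ etaFst p (ρ R) (t R) = c) → etaSnd p 1 (t 1) = c := fun c t ht => by
    rw [etaSnd_one_eq_etaFst_one, ← (ht 1 hone).2, hρid 1 ⟨h1.le, le_rfl⟩]
  refine ⟨?_, ?_, ?_⟩
  · rintro ⟨τ, R⟩ ⟨hτ, hR⟩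
    have hR' : R ∈ Ioc (-1 : ℝ) 1 := Ioo_subset_Ioc_self hR
    have hc := etaFst_mem_Ioo hp (hρ' R hR') hτ
    obtain ⟨t, ht⟩ := level _ hc
    have hm := strictMonoOn_etaSnd_level hp h0 h1 hcrit hρid hρ ht
    have hτt : t R = τ := uniq R hR' _ (ht R hR').1 _ hτ (ht R hR').2
    have hlt := hm hR' hone hR.2
    simp only [endpoint _ t ht, hτt] at hlt
    refine ⟨?_, hlt, hc.2⟩
    rcases lt_or_ge R 0 with hneg | hnonneg
    · have := neg_one_lt_etaSnd_neg (x := -R) hp ⟨neg_pos.2 hneg, by linarith [hR.1]⟩ hτ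
      rwa [neg_neg] at this
    · have hhalf : (-(1 / 2) : ℝ) ∈ Ioc (-1 : ℝ) 1 := by norm_num
      have h2 := hm hhalf hR' (by linarith)
      have h3 := neg_one_lt_etaSnd_neg (x := 1 / 2) hp (by norm_num) (ht _ hhalf).1
      simp only [hτt] at h2
      exact h3.trans h2
  · rintro ⟨τ₁, R₁⟩ ⟨hτ₁, hR₁⟩ ⟨τ₂, R₂⟩ ⟨hτ₂, hR₂⟩ heq
    simp only [Prod.mk.injEq] at heq hτ₁ hR₁ hτ₂ hR₂
    have hR₁' : R₁ ∈ Ioc (-1 : ℝ) 1 := Ioo_subset_Ioc_self hR₁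
    have hR₂' : R₂ ∈ Ioc (-1 : ℝ) 1 := Ioo_subset_Ioc_self hR₂
    obtain ⟨t, ht⟩ := level _ (etaFst_mem_Ioo hp (hρ' R₁ hR₁') hτ₁)
    have hm := strictMonoOn_etaSnd_level hp h0 h1 hcrit hρid hρ ht
    have e₁ : t R₁ = τ₁ := uniq R₁ hR₁' _ (ht R₁ hR₁').1 _ hτ₁ (ht R₁ hR₁').2
    have e₂ : t R₂ = τ₂ := uniq R₂ hR₂' _ (ht R₂ hR₂').1 _ hτ₂ ((ht R₂ hR₂').2.trans heq.1)
    have hR : R₁ = R₂ := hm.injOn hR₁' hR₂' (by simpa only [e₁, e₂] using heq.2)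
    subst hR
    rw [← e₁, ← e₂]
  · rintro ⟨y₁, y₂⟩ ⟨hy₂, hy, hy₁⟩
    simp only at hy₂ hy hy₁
    obtain ⟨t, ht⟩ := level y₁ ⟨hy₂.trans hy, hy₁⟩
    have hcont := continuousOn_etaSnd_level hp h0 (strictMonoOn_lam hp h0 h1 hcrit) hρ ht
    obtain ⟨x, hx, hxy⟩ : ∃ x ∈ Ioo (0 : ℝ) 1, -y₂ < x ^ (p - 1) := by
      have hlim : Tendsto (fun x : ℝ => x ^ (p - 1)) (𝓝[<] 1) (𝓝 1) := by
        have := (Real.continuousAt_rpow_const 1 (p - 1) (Or.inl one_ne_zero)).tendsto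
        rw [Real.one_rpow] at this
        exact this.mono_left nhdsWithin_le_nhds
      obtain ⟨x, hx, hx'⟩ := ((hlim.eventually (lt_mem_nhds (by linarith : -y₂ < 1))).and
        (Ioo_mem_nhdsLT zero_lt_one)).exists
      exact ⟨x, hx', hx⟩
    have hle : -x ≤ 1 := by linarith [hx.1]
    have hx' : -x ∈ Ioc (-1 : ℝ) 1 := ⟨by linarith [hx.2], hle⟩
    have hlow := etaSnd_neg_le hp hx (ht _ hx').1
    obtain ⟨R, hR, hRy⟩ := intermediate_value_Ioo hle
      (hcont.mono fun z hz => ⟨hx'.1.trans_le hz.1, hz.2⟩)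
      (show y₂ ∈ Ioo _ _ from ⟨by linarith, by simpa only [endpoint _ t ht] using hy⟩)
    have hR' : R ∈ Ioc (-1 : ℝ) 1 := ⟨hx'.1.trans hR.1, hR.2.le⟩
    exact ⟨(t R, R), ⟨(ht R hR').1, hR'.1, hR.2⟩, Prod.ext (ht R hR').2 hRy⟩

end LevelSets

theorem eta_bijective (p q : ℝ) (hp : 2 < p) (hq : q = p / (p - 1))
    (R₀ : ℝ) (hR₀mem : R₀ ∈ Set.Ioo (0 : ℝ) 1)
    (hR₀eq : R₀ ^ ((p - 1) / 2) + R₀ ^ (-((p - 1) / 2))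
      = (p - 1) * (R₀ ^ ((1 : ℝ) / 2) + R₀ ^ (-(1 : ℝ) / 2)))
    (ρ : ℝ → ℝ)
    (hρ₁ : ∀ R ∈ Set.Icc R₀ (1 : ℝ), ρ R = R)
    (hρ₂ : ∀ R ∈ Set.Icc (-1 : ℝ) R₀, ρ R ∈ Set.Icc R₀ 1 ∧ lam p (ρ R) = lam p R) :
    Set.BijOn
      (fun z : ℝ × ℝ =>
        ((-z.1 + (1 - z.1) * ρ z.2) / (z.1 + (1 - z.1) * ρ z.2 ^ p) ^ ((1 : ℝ) / p),
         (-z.1 + (1 - z.1) * phi p z.2) / (z.1 + (1 - z.1) * |z.2| ^ p) ^ ((1 : ℝ) / q)))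
      (Set.Ioo (0 : ℝ) 1 ×ˢ Set.Ioo (-1 : ℝ) 1)
      {y : ℝ × ℝ | -1 < y.2 ∧ y.2 < y.1 ∧ y.1 < 1} := by
  have hq' : (1 : ℝ) / q = (p - 1) / p := by rw [hq, one_div_div]
  rw [hq']
  refine bijOn_etaFst_etaSnd hp hR₀mem.1 hR₀mem.2 (critical_ratio_eq hR₀mem.1 hR₀eq) hρ₁
    fun R hR => ?_
  rcases le_total R R₀ with h | h
  · exact hρ₂ R ⟨hR.1.le, h⟩
  · rw [hρ₁ R ⟨h, hR.2⟩]
    exact ⟨⟨h, hR.2⟩, rfl⟩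
end

section
/- Fix p > 2. For every t ∈ [0,1], λ(−t) ≥ λ(t), where λ(R) = 1/(1+R) − (p−1)/(1 + R|R|^{p−2}) for R ≠ −1 and λ(−1) = −(p−2)/2. Equivalently, for t ∈ [0,1): 1/(1−t) − 1/(1+t) ≥ (p−1)/(1−t^{p−1}) − (p−1)/(1+t^{p−1}). -/
theorem mul_sinh_le_sinh_mul {q x : ℝ} (hq : 1 ≤ q) (hx : 0 ≤ x) :
    q * Real.sinh x ≤ Real.sinh (q * x) := by
  have hd (y : ℝ) : HasDerivAt (fun y => Real.sinh (q * y) - q * Real.sinh y)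
      (Real.cosh (q * y) * (q * 1) - q * Real.cosh y) y :=
    (((hasDerivAt_id y).const_mul q).sinh).sub ((Real.hasDerivAt_sinh y).const_mul q)
  have hmono : MonotoneOn (fun y => Real.sinh (q * y) - q * Real.sinh y) (Set.Ici 0) := by
    refine monotoneOn_of_deriv_nonneg (convex_Ici 0)
      (fun y _ => (hd y).continuousAt.continuousWithinAt)
      (fun y _ => (hd y).differentiableAt.differentiableWithinAt) fun y hy => ?_
    rw [interior_Ici, Set.mem_Ioi] at hy
    rw [(hd y).deriv]
    have hc : Real.cosh y ≤ Real.cosh (q * y) := by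
      rw [Real.cosh_le_cosh, abs_of_pos hy, abs_of_pos (by positivity)]
      exact le_mul_of_one_le_left hy.le hq
    nlinarith
  have h := hmono (Set.mem_Ici.2 le_rfl) (Set.mem_Ici.2 hx) hx
  simpa using h

theorem div_one_sub_rpow_sub_div_one_add_rpow_le {q t : ℝ} (hq : 1 < q) (ht : 0 ≤ t) (ht1 : t < 1) :
    q / (1 - t ^ q) - q / (1 + t ^ q) ≤ 1 / (1 - t) - 1 / (1 + t) := by
  rcases ht.eq_or_lt with rfl | ht0
  · simp [Real.zero_rpow (by linarith : q ≠ 0)]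
  have hs0 : 0 < t ^ q := Real.rpow_pos_of_pos ht0 q
  have hs1 : t ^ q < 1 := Real.rpow_lt_one ht ht1 (by linarith)
  have h := mul_sinh_le_sinh_mul hq.le (neg_nonneg.2 (Real.log_nonpos ht ht1.le))
  have hexp : Real.exp (q * Real.log t) = t ^ q := by
    rw [Real.rpow_def_of_pos ht0, mul_comm]
  rw [Real.sinh_eq, Real.sinh_eq, mul_neg, neg_neg, neg_neg, Real.exp_neg, Real.exp_neg,
    Real.exp_log ht0, hexp] at h
  generalize t ^ q = s at *
  have key : q * s * (1 - t ^ 2) ≤ t * (1 - s ^ 2) := by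
    have h2 := mul_le_mul_of_nonneg_left h (by positivity : 0 ≤ 2 * s * t)
    have e1 : 2 * s * t * (q * ((t⁻¹ - t) / 2)) = q * s * (1 - t ^ 2) := by field_simp
    have e2 : 2 * s * t * ((s⁻¹ - s) / 2) = t * (1 - s ^ 2) := by field_simp
    rwa [e1, e2] at h2
  have a : 0 < 1 - t := by linarith
  have b : 0 < 1 - s := by linarith
  have e1 : q / (1 - s) - q / (1 + s) = 2 * (q * s) / (1 - s ^ 2) := by
    rw [show 1 - s ^ 2 = (1 - s) * (1 + s) by ring]
    field_simp
    ring
  have e2 : 1 / (1 - t) - 1 / (1 + t) = 2 * t / (1 - t ^ 2) := by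
    rw [show 1 - t ^ 2 = (1 - t) * (1 + t) by ring]
    field_simp
    ring
  rw [e1, e2, div_le_div_iff₀ (by nlinarith) (by nlinarith)]
  linarith

theorem phi_of_nonneg {p t : ℝ} (hp : 1 < p) (ht : 0 ≤ t) : phi p t = t ^ (p - 1) := by
  rcases ht.eq_or_lt with rfl | ht0
  · simp [phi, Real.zero_rpow (by linarith : p - 1 ≠ 0)]
  · rw [phi, abs_of_pos ht0, show p - 1 = 1 + (p - 2) by ring, Real.rpow_add ht0, Real.rpow_one]

theorem phi_neg (p t : ℝ) : phi p (-t) = -phi p t := by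
  simp [phi]

theorem lam_neg_ge_lam (p : ℝ) (hp : 2 < p) :
    (∀ t ∈ Set.Icc (0 : ℝ) 1, lam p t ≤ lam p (-t)) ∧
    (∀ t ∈ Set.Ico (0 : ℝ) 1,
      (p - 1) / (1 - t ^ (p - 1)) - (p - 1) / (1 + t ^ (p - 1))
        ≤ 1 / (1 - t) - 1 / (1 + t)) := by
  refine ⟨fun t ⟨ht0, ht1⟩ => ?_, fun t ht => div_one_sub_rpow_sub_div_one_add_rpow_le (by linarith) ht.1 ht.2⟩
  rcases ht1.eq_or_lt with rfl | ht1
  · rw [lam, lam, if_neg (by norm_num), if_pos rfl, phi_of_nonneg (by linarith) zero_le_one,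
      Real.one_rpow]
    linarith
  · rw [lam, lam, if_neg (by linarith), if_neg (by linarith), phi_neg,
      phi_of_nonneg (by linarith) ht0, ← sub_eq_add_neg, ← sub_eq_add_neg]
    linarith [div_one_sub_rpow_sub_div_one_add_rpow_le (q := p - 1) (by linarith) ht0 ht1]
end
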